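/- Let (R,m) be a complete Noetherian local ring of Krull dimension d containing a field, let f = (f₁,…,f_r) be a system of polynomials in R[X₁,…,X_N], and let t₁,…,t_{d−1} ∈ R be elements such that for each i, tᵢ does not lie in any minimal prime of the ideal (t₁,…,t_{i−1}). Then there exists a linear function β : ℕ → ℕ with the following property: for each n ∈ ℕ and each a ∈ R^N satisfying fᵢ(a) ∈ m^{β(n)} for all i and (f₁(a),…,f_r(a)) + H_{f/R}(a) ⊇ (t₁,…,t_{d−1}), there exists b ∈ R^N with fᵢ(b) = 0 for all i and a ≡ b (mod m^n R^N). -/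

import Mathlib

open MvPolynomial IsLocalRing

/-- Elkik's ideal `H_{f/R}`: the sum over `1 ≤ i₁ < ⋯ < i_p ≤ r` of
`Δ(i₁,…,i_p) · ((f_{i₁},…,f_{i_p}) : (f₁,…,f_r))`, where `Δ(i₁,…,i_p)` is generated by the
`p × p` minors of the Jacobian matrix `(∂f_{i_j}/∂X_k)`. -/
noncomputable def elkikH {R : Type*} [CommRing R] {σ : Type*} [DecidableEq σ] {r : ℕ}
    (f : Fin r → MvPolynomial σ R) : Ideal (MvPolynomial σ R) :=
  ⨆ (p : ℕ) (_ : 0 < p) (rows : Fin p → Fin r) (_ : StrictMono rows),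
    Ideal.span {d | ∃ cols : Fin p → σ,
        d = (Matrix.of fun j k : Fin p => pderiv (cols k) (f (rows j))).det} *
      (Ideal.span (Set.range (f ∘ rows))).colon (Ideal.span (Set.range f))

open scoped TensorProduct

/-- First-order expansion of a polynomial. -/
lemma eval_add_sub_mem {R σ : Type*} [CommRing R] (D : Ideal R) (a δ : σ → R)
    (hδ : ∀ k, δ k ∈ D) (f : MvPolynomial σ R) :
    eval (a + δ) f - eval a f ∈ D := by
  induction f using MvPolynomial.induction_on with
  | C c => simp
  | add p q hp hq =>
    have : eval (a + δ) (p + q) - eval a (p + q)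
      = (eval (a + δ) p - eval a p) + (eval (a + δ) q - eval a q) := by
      simp only [map_add]; ring
    rw [this]; exact D.add_mem hp hq
  | mul_X p k hp =>
    have : eval (a + δ) (p * X k) - eval a (p * X k)
      = (eval (a + δ) p - eval a p) * (a k + δ k) + eval a p * δ k := by
      simp only [map_mul, eval_X, Pi.add_apply]; ring
    rw [this]
    exact D.add_mem (D.mul_mem_right _ hp) (D.mul_mem_left _ (hδ k))

lemma eval_sub_eval_mem {R σ : Type*} [CommRing R] (D : Ideal R) (a b : σ → R)
    (hδ : ∀ k, a k - b k ∈ D) (f : MvPolynomial σ R) :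
    eval a f - eval b f ∈ D := by
  have := eval_add_sub_mem D b (a - b) (by simpa using hδ) f
  simpa using this

/-- Second-order expansion of a polynomial. -/
lemma eval_add_taylor {R σ : Type*} [Fintype σ] [CommRing R] (D : Ideal R) (a δ : σ → R)
    (hδ : ∀ k, δ k ∈ D) (f : MvPolynomial σ R) :
    eval (a + δ) f - eval a f - ∑ k, eval a (pderiv k f) * δ k ∈ D ^ 2 := by
  classical
  induction f using MvPolynomial.induction_on with
  | C c => simp
  | add p q hp hq =>
    have : eval (a + δ) (p + q) - eval a (p + q) - ∑ k, eval a (pderiv k (p + q)) * δ k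
      = (eval (a + δ) p - eval a p - ∑ k, eval a (pderiv k p) * δ k) +
        (eval (a + δ) q - eval a q - ∑ k, eval a (pderiv k q) * δ k) := by
      simp only [map_add, add_mul, Finset.sum_add_distrib]; ring
    rw [this]; exact Ideal.add_mem _ hp hq
  | mul_X p j hp =>
    have h1 : ∑ k, eval a (pderiv k (p * X j)) * δ k
        = (∑ k, eval a (pderiv k p) * δ k) * a j + eval a p * δ j := by
      have : ∀ k, eval a (pderiv k (p * X j)) * δ k
          = eval a (pderiv k p) * δ k * a j + (if k = j then eval a p * δ j else 0) := by
        intro k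
        rw [Derivation.leibniz]
        by_cases h : k = j
        · subst h; simp; ring
        · rw [pderiv_X_of_ne (Ne.symm h)]; simp [h]; ring
      simp only [this, Finset.sum_add_distrib, Finset.sum_mul]
      simp
    have : eval (a + δ) (p * X j) - eval a (p * X j) - ∑ k, eval a (pderiv k (p * X j)) * δ k
      = (eval (a + δ) p - eval a p - ∑ k, eval a (pderiv k p) * δ k) * a j
        + (eval (a + δ) p - eval a p) * δ j := by
      rw [h1]
      simp only [map_mul, eval_X, Pi.add_apply]; ring
    rw [this]
    refine Ideal.add_mem _ (Ideal.mul_mem_right _ _ hp) ?_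
    rw [pow_two]
    exact Ideal.mul_mem_mul (eval_add_sub_mem D a δ hδ p) (hδ j)

/-- The ideal of polynomials `h` for which `h • (I / I²) → I / I²` factors through the
differential. -/
def goodIdeal {R σ : Type*} [Fintype σ] [CommRing R] (I : Ideal (MvPolynomial σ R)) :
    Ideal (MvPolynomial σ R) where
  carrier := {h | ∃ m : σ → MvPolynomial σ R, (∀ k, m k ∈ I) ∧
    ∀ f ∈ I, h * f - ∑ k, pderiv k f * m k ∈ I ^ 2}
  zero_mem' := ⟨0, by simp, by simp⟩
  add_mem' := by
    rintro x y ⟨m, hm, hm2⟩ ⟨m', hm', hm2'⟩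
    refine ⟨m + m', fun k => I.add_mem (hm k) (hm' k), fun f hf => ?_⟩
    have : (x + y) * f - ∑ k, pderiv k f * (m + m') k
      = (x * f - ∑ k, pderiv k f * m k) + (y * f - ∑ k, pderiv k f * m' k) := by
      simp only [Pi.add_apply, mul_add, Finset.sum_add_distrib]; ring
    rw [this]; exact Ideal.add_mem _ (hm2 f hf) (hm2' f hf)
  smul_mem' := by
    rintro c x ⟨m, hm, hm2⟩
    refine ⟨c • m, fun k => I.mul_mem_left _ (hm k), fun f hf => ?_⟩
    have : (c • x) * f - ∑ k, pderiv k f * (c • m) k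
      = c * (x * f - ∑ k, pderiv k f * m k) := by
      simp only [Pi.smul_apply, smul_eq_mul, mul_sub, Finset.mul_sum]
      congr 1
      · ring
      · exact Finset.sum_congr rfl fun k _ => by ring
    rw [this]; exact Ideal.mul_mem_left _ _ (hm2 f hf)

lemma mem_goodIdeal {R σ : Type*} [Fintype σ] [CommRing R] {I : Ideal (MvPolynomial σ R)}
    {h : MvPolynomial σ R} : h ∈ goodIdeal I ↔ ∃ m : σ → MvPolynomial σ R, (∀ k, m k ∈ I) ∧
    ∀ f ∈ I, h * f - ∑ k, pderiv k f * m k ∈ I ^ 2 := Iff.rfl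

/-- Ideals of a Noetherian local ring are closed. -/
lemma mem_of_forall_mem_sup_pow {R : Type*} [CommRing R] [IsNoetherianRing R] [IsLocalRing R]
    (J : Ideal R) (y : R) (h : ∀ k, y ∈ J ⊔ maximalIdeal R ^ k) : y ∈ J := by
  have hH : IsHausdorff (maximalIdeal R) (R ⧸ J) := inferInstance
  rw [← Ideal.Quotient.eq_zero_iff_mem]
  refine hH.haus _ fun n => ?_
  rw [SModEq.zero]
  obtain ⟨u, hu, v, hv, rfl⟩ := Submodule.mem_sup.1 (h n)
  rw [map_add, Ideal.Quotient.eq_zero_iff_mem.2 hu, zero_add]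
  have : (Ideal.Quotient.mk J v) = v • (1 : R ⧸ J) := by
    rw [Algebra.smul_def, mul_one]; rfl
  rw [this]
  exact Submodule.smul_mem_smul hv trivial

lemma eq_zero_of_forall_mem_pow {R : Type*} [CommRing R] [IsNoetherianRing R] [IsLocalRing R]
    (y : R) (h : ∀ k, y ∈ maximalIdeal R ^ k) : y = 0 := by
  have := mem_of_forall_mem_sup_pow (⊥ : Ideal R) y (fun k => by simpa using h k)
  simpa using this

/-- Limits of successive approximations. -/
lemma exists_limit_of_step {R σ : Type*} [CommRing R] [IsLocalRing R]
    [IsAdicComplete (maximalIdeal R) R] (Q : ℕ → (σ → R) → Prop)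
    (n₀ : ℕ) (step : ∀ n ≥ n₀, ∀ a, Q n a → ∃ b, (∀ k, a k - b k ∈ maximalIdeal R ^ n) ∧ Q (n + 1) b)
    (a : σ → R) (ha : Q n₀ a) :
    ∃ b : σ → R, ∀ j, ∃ a', Q (n₀ + j) a' ∧ ∀ k, a' k - b k ∈ maximalIdeal R ^ (n₀ + j) := by
  classical
  choose! g hg1 hg2 using step
  let s : ℕ → (σ → R) := fun j => Nat.rec a (fun j x => g (n₀ + j) x) j
  have hs : ∀ j, Q (n₀ + j) (s j) := by
    intro j
    induction j with
    | zero => exact ha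
    | succ j ih => exact hg2 (n₀ + j) (Nat.le_add_right _ _) _ ih
  have hs1 : ∀ j k, s j k - s (j + 1) k ∈ maximalIdeal R ^ (n₀ + j) := fun j k =>
    hg1 _ (by omega) _ (hs j) k
  have hs2 : ∀ i j, ∀ k, s j k - s (j + i) k ∈ maximalIdeal R ^ (n₀ + j) := by
    intro i
    induction i with
    | zero => intro j k; simp
    | succ i ih =>
      intro j k
      have := Ideal.add_mem _ (ih j k)
        (Ideal.pow_le_pow_right (by omega : n₀ + j ≤ n₀ + (j + i)) (hs1 (j + i) k))
      simpa [add_assoc] using this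
  have key : ∀ k, ∃ L, ∀ n, (s n k) ≡ L [SMOD maximalIdeal R ^ n • (⊤ : Submodule R R)] := by
    intro k
    refine IsPrecomplete.prec' (I := maximalIdeal R) (fun n => s n k) ?_
    intro m n hmn
    obtain ⟨i, rfl⟩ := Nat.exists_eq_add_of_le hmn
    rw [SModEq.sub_mem]
    have := Ideal.pow_le_pow_right (by omega : m ≤ n₀ + m) (hs2 i m k)
    simpa using this
  choose b hb using key
  refine ⟨b, fun j => ⟨s j, hs j, fun k => ?_⟩⟩
  have h1 := hb k (n₀ + j)
  rw [SModEq.sub_mem] at h1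
  have h2 := hs2 n₀ j k
  rw [add_comm j n₀] at h2
  have := Ideal.add_mem _ h2 (by simpa using h1 : s (n₀ + j) k - b k ∈ maximalIdeal R ^ (n₀ + j))
  simpa using this

/-- One Newton step, modulo an ideal `I₀`. -/
lemma newton_step {R σ : Type*} [Fintype σ] [CommRing R] [IsLocalRing R]
    (I₀ : Ideal R) (I : Ideal (MvPolynomial σ R)) (t : R) (c n : ℕ) (hc : 2 ≤ c) (hn : 1 ≤ n)
    (hann : ∀ y, t ^ c * y ∈ I₀ → t ^ (c - 1) * y ∈ I₀)
    (a : σ → R) (h : MvPolynomial σ R) (hh : h ∈ goodIdeal I) (hha : eval a h = t)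
    (ha : ∀ p ∈ I, eval a p ∈ I₀ ⊔ Ideal.span {t ^ c} * maximalIdeal R ^ n) :
    ∃ b : σ → R, (∀ k, a k - b k ∈ Ideal.span {t} * maximalIdeal R ^ n) ∧
      (∀ p ∈ I, eval b p ∈ I₀ ⊔ Ideal.span {t ^ c} * maximalIdeal R ^ (n + 1)) ∧
      ∃ h' ∈ goodIdeal I, eval b h' = t := by
  obtain ⟨m, hmI, hm⟩ := hh
  have h1 : ∀ k, ∃ i ∈ I₀, ∃ μ ∈ maximalIdeal R ^ n, eval a (m k) = i + t ^ c * μ := by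
    intro k
    obtain ⟨i, hi, z, hz, hiz⟩ := Submodule.mem_sup.1 (ha _ (hmI k))
    obtain ⟨μ, hμ, rfl⟩ := Ideal.mem_span_singleton_mul.1 hz
    exact ⟨i, hi, μ, hμ, hiz.symm⟩
  choose i hi μ hμ hmμ using h1
  let δ : σ → R := fun k => - (t ^ (c - 1) * μ k)
  set D := Ideal.span {t ^ (c - 1)} * maximalIdeal R ^ n with hD
  have hδ : ∀ k, δ k ∈ D := fun k =>
    D.neg_mem (Ideal.mul_mem_mul (Ideal.mem_span_singleton_self _) (hμ k))
  have hDt : D ≤ Ideal.span {t} * maximalIdeal R ^ n := by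
    refine Ideal.mul_mono_left ?_
    rw [Ideal.span_singleton_le_span_singleton]
    exact dvd_pow_self t (by omega)
  have hD2 : D ^ 2 ≤ Ideal.span {t ^ c} * maximalIdeal R ^ (n + 1) := by
    rw [hD, mul_pow, Ideal.span_singleton_pow, ← pow_mul, ← pow_mul]
    refine Ideal.mul_mono ?_ (Ideal.pow_le_pow_right (by omega))
    rw [Ideal.span_singleton_le_span_singleton]
    exact pow_dvd_pow t (by omega)
  refine ⟨a + δ, fun k => ?_, fun p hp => ?_, ?_⟩
  · have := (Ideal.span {t} * maximalIdeal R ^ n).neg_mem (hDt (hδ k))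
    simpa using this
  · obtain ⟨i', hi', z, hz, hiz⟩ := Submodule.mem_sup.1 (ha _ hp)
    obtain ⟨u, hu, rfl⟩ := Ideal.mem_span_singleton_mul.1 hz
    have hsq : eval a (h * p - ∑ k, pderiv k p * m k) ∈
        I₀ ⊔ Ideal.span {t ^ (2 * c)} * maximalIdeal R ^ (2 * n) := by
      have e1 : I.map (eval a) ≤ I₀ ⊔ Ideal.span {t ^ c} * maximalIdeal R ^ n :=
        Ideal.map_le_iff_le_comap.2 ha
      have e2 := Ideal.mem_map_of_mem (eval a) (hm p hp)
      rw [Ideal.map_pow] at e2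
      have e3 := Ideal.pow_right_mono e1 2 e2
      refine (?_ : (I₀ ⊔ Ideal.span {t ^ c} * maximalIdeal R ^ n) ^ 2 ≤ _) e3
      rw [pow_two, Ideal.sup_mul, Ideal.mul_sup (Ideal.span {t ^ c} * maximalIdeal R ^ n)]
      refine sup_le (le_sup_of_le_left Ideal.mul_le_left)
        (sup_le (le_sup_of_le_left Ideal.mul_le_right) (le_sup_of_le_right ?_))
      rw [← pow_two, mul_pow, Ideal.span_singleton_pow, ← pow_mul, ← pow_mul, mul_comm c, mul_comm n]
    obtain ⟨i2, hi2, z, hz, hiz2⟩ := Submodule.mem_sup.1 hsq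
    obtain ⟨w, hw, rfl⟩ := Ideal.mem_span_singleton_mul.1 hz
    have hT := eval_add_taylor D a δ hδ p
    set S := ∑ k, eval a (pderiv k p) * μ k with hS
    have hsumδ : ∑ k, eval a (pderiv k p) * δ k = - (t ^ (c - 1) * S) := by
      rw [hS, Finset.mul_sum, ← Finset.sum_neg_distrib]
      exact Finset.sum_congr rfl fun k _ => by simp only [δ]; ring
    have hsumm : eval a (h * p - ∑ k, pderiv k p * m k)
        = t * (i' + t ^ c * u) - (∑ k, eval a (pderiv k p) * i k) - t ^ c * S := by
      rw [map_sub, map_mul, hha, hiz, map_sum, hS, Finset.mul_sum, sub_sub,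
        ← Finset.sum_add_distrib]
      congr 1
      exact Finset.sum_congr rfl fun k _ => by rw [map_mul, hmμ]; ring
    have hz : t ^ c * (t * u - S - t ^ c * w) ∈ I₀ := by
      have : t ^ c * (t * u - S - t ^ c * w)
          = i2 - t * i' + ∑ k, eval a (pderiv k p) * i k := by
        rw [hsumm] at hiz2
        have h2c : t ^ (2 * c) = t ^ c * t ^ c := by rw [two_mul, pow_add]
        rw [h2c] at hiz2
        linear_combination -hiz2
      rw [this]
      exact I₀.add_mem (I₀.sub_mem hi2 (I₀.mul_mem_left _ hi'))
        (I₀.sum_mem fun k _ => I₀.mul_mem_left _ (hi k))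
    have hz' := hann _ hz
    have hfin : eval (a + δ) p = (i' + t ^ (c - 1) * (t * u - S - t ^ c * w)) +
        ((eval (a + δ) p - eval a p - ∑ k, eval a (pderiv k p) * δ k) +
          t ^ c * (t ^ (c - 1) * w)) := by
      rw [hsumδ, ← hiz]
      have : t ^ c = t ^ (c - 1) * t := by rw [← pow_succ]; congr 1; omega
      rw [this]; ring
    rw [hfin]
    refine Ideal.add_mem _ (Ideal.mem_sup_left (I₀.add_mem hi' hz'))
      (Ideal.mem_sup_right (Ideal.add_mem _ (hD2 hT) ?_))
    refine Ideal.mul_mem_mul (Ideal.mem_span_singleton_self _) (Ideal.mul_mem_left _ _ ?_)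
    exact Ideal.pow_le_pow_right (by omega) hw
  · have h1 := hDt (eval_add_sub_mem D a δ hδ h)
    obtain ⟨ν, hν, hν'⟩ := Ideal.mem_span_singleton_mul.1 h1
    have hνm : ν ∈ maximalIdeal R := Ideal.pow_le_self (by omega) hν
    have hunit : IsUnit (1 + ν) := by
      by_contra hcon
      have h3 : (1 + ν) ∈ maximalIdeal R := hcon
      have h2 := Ideal.sub_mem _ h3 hνm
      simp at h2
    obtain ⟨v, hv⟩ := hunit
    refine ⟨C (↑v⁻¹ : R) * h, Ideal.mul_mem_left _ _ ⟨m, hmI, hm⟩, ?_⟩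
    have : eval (a + δ) h = t * (1 + ν) := by rw [hha] at hν'; linear_combination -hν'
    rw [map_mul, eval_C, this, ← hv, mul_comm t, ← mul_assoc, Units.inv_mul, one_mul]

/-- Newton's lemma, modulo an ideal `I₀`. -/
lemma newton {R σ : Type*} [Fintype σ] [CommRing R] [IsNoetherianRing R] [IsLocalRing R]
    [IsAdicComplete (maximalIdeal R) R]
    (I₀ : Ideal R) (I : Ideal (MvPolynomial σ R)) (t : R) (c n : ℕ) (hc : 2 ≤ c) (hn : 1 ≤ n)
    (hann : ∀ y, t ^ c * y ∈ I₀ → t ^ (c - 1) * y ∈ I₀)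
    (a : σ → R) (h : MvPolynomial σ R) (hh : h ∈ goodIdeal I) (hha : eval a h = t)
    (ha : ∀ p ∈ I, eval a p ∈ I₀ ⊔ Ideal.span {t ^ c} * maximalIdeal R ^ n) :
    ∃ b : σ → R, (∀ k, a k - b k ∈ Ideal.span {t} * maximalIdeal R ^ n) ∧
      (∀ p ∈ I, eval b p ∈ I₀) := by
  obtain ⟨b, hb⟩ := exists_limit_of_step (σ := σ)
    (fun n' a' => (∀ p ∈ I, eval a' p ∈ I₀ ⊔ Ideal.span {t ^ c} * maximalIdeal R ^ n') ∧
      (∃ h' ∈ goodIdeal I, eval a' h' = t) ∧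
      ∀ k, a k - a' k ∈ Ideal.span {t} * maximalIdeal R ^ n) n
    (by
      rintro n' hn' a' ⟨h1, ⟨h', hh', hha'⟩, h3⟩
      obtain ⟨b, hb1, hb2, hb3⟩ :=
        newton_step I₀ I t c n' hc (by omega) hann a' h' hh' hha' h1
      refine ⟨b, fun k => Ideal.mul_le_right (hb1 k), hb2, hb3, fun k => ?_⟩
      have := Ideal.add_mem _ (h3 k)
        (Ideal.mul_mono_right (Ideal.pow_le_pow_right hn') (hb1 k))
      simpa using this) a ⟨ha, ⟨h, hh, hha⟩, by simp⟩
  refine ⟨b, fun k => ?_, fun p hp => ?_⟩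
  · refine mem_of_forall_mem_sup_pow _ _ fun j => ?_
    obtain ⟨a', ⟨-, -, h3⟩, h4⟩ := hb j
    have := Ideal.add_mem _ (Ideal.mem_sup_left (h3 k))
      (Ideal.mem_sup_right (Ideal.pow_le_pow_right (by omega : j ≤ n + j) (h4 k)))
    simpa using this
  · refine mem_of_forall_mem_sup_pow _ _ fun j => ?_
    obtain ⟨a', ⟨h1, -, -⟩, h4⟩ := hb j
    have h5 := eval_sub_eval_mem _ a' b h4 p
    have h6 : I₀ ⊔ Ideal.span {t ^ c} * maximalIdeal R ^ (n + j) ≤ I₀ ⊔ maximalIdeal R ^ j :=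
      sup_le_sup_left (Ideal.mul_le_right.trans (Ideal.pow_le_pow_right (by omega))) _
    have := Ideal.sub_mem _ (h6 (h1 p hp))
      (Ideal.mem_sup_right (Ideal.pow_le_pow_right (by omega : j ≤ n + j) h5))
    simpa using this


lemma dvr_mem_pow_iff {A : Type*} [CommRing A] [IsDomain A] [IsDiscreteValuationRing A]
    {x : A} (hx : Irreducible x) (n : ℕ) (y : A) : y ∈ maximalIdeal A ^ n ↔ x ^ n ∣ y := by
  rw [hx.maximalIdeal_eq, Ideal.span_singleton_pow, Ideal.mem_span_singleton]

lemma ppow_est_aux {A : Type*} [CommRing A] [IsDomain A] [IsDiscreteValuationRing A]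
    (p : ℕ) {ι : Type*} (c : ι → A) (s : Finset ι) (e : ℕ)
    (he : ∀ y : ι → A, ∑ i ∈ s, c i * y i ^ p ∈ maximalIdeal A ^ e →
      ∀ i ∈ s, y i ∈ maximalIdeal A) (m : ℕ) :
    ∀ y : ι → A, ∑ i ∈ s, c i * y i ^ p ∈ maximalIdeal A ^ (p * m + e) →
      ∀ i ∈ s, y i ∈ maximalIdeal A ^ m := by
  classical
  obtain ⟨x, hx⟩ := IsDiscreteValuationRing.exists_irreducible A
  induction m with
  | zero => intro y _ i _; simp
  | succ m ih =>
    intro y hy i hi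
    have h1 := he y (Ideal.pow_le_pow_right (by omega) hy)
    have h2 : ∀ i ∈ s, x ∣ y i := fun i hi => by
      have := h1 i hi
      rwa [hx.maximalIdeal_eq, Ideal.mem_span_singleton] at this
    have h3 : ∃ z : ι → A, ∀ i ∈ s, y i = x * z i := by
      refine ⟨fun i => if h : i ∈ s then (h2 i h).choose else 0, fun i hi => ?_⟩
      simp only [hi, dif_pos]
      exact (h2 i hi).choose_spec
    obtain ⟨z, hz⟩ := h3
    have h4 : ∑ i ∈ s, c i * y i ^ p = x ^ p * ∑ i ∈ s, c i * z i ^ p := by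
      rw [Finset.mul_sum]
      exact Finset.sum_congr rfl fun i hi => by rw [hz i hi]; ring
    rw [dvr_mem_pow_iff hx, h4, show p * (m + 1) + e = p + (p * m + e) by ring, pow_add] at hy
    have h5 := (mul_dvd_mul_iff_left (pow_ne_zero p hx.ne_zero)).1 hy
    have h6 := ih z ((dvr_mem_pow_iff hx _ _).2 h5) i hi
    rw [dvr_mem_pow_iff hx] at h6 ⊢
    rw [hz i hi, pow_succ, mul_comm]
    exact mul_dvd_mul_left x h6

lemma ppow_est {A : Type*} [CommRing A] [IsDomain A] [IsDiscreteValuationRing A]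
    [IsAdicComplete (maximalIdeal A) A] (p : ℕ) [hp : Fact p.Prime] [CharP A p]
    {ι : Type*} [DecidableEq ι] (c : ι → A) (N : ℕ) : ∀ (s : Finset ι), s.card = N →
    (∀ y : ι → A, ∑ i ∈ s, c i * y i ^ p = 0 → ∀ i ∈ s, y i = 0) →
    ∃ e, ∀ m, ∀ y : ι → A, ∑ i ∈ s, c i * y i ^ p ∈ maximalIdeal A ^ (p * m + e) →
      ∀ i ∈ s, y i ∈ maximalIdeal A ^ m := by
  have hp0 : p ≠ 0 := hp.out.ne_zero
  induction N with
  | zero =>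
    intro s hs _
    rw [Finset.card_eq_zero] at hs
    subst hs
    exact ⟨0, by simp⟩
  | succ N ih =>
    intro s hs hind
    suffices H : ∀ i ∈ s, ∃ e, ∀ y : ι → A, ∑ i ∈ s, c i * y i ^ p ∈ maximalIdeal A ^ e →
        y i ∈ maximalIdeal A by
      choose! e he using H
      refine ⟨s.sup e, fun m => ppow_est_aux p c s _ (fun y hy i hi => ?_) m⟩
      exact he i hi y (Ideal.pow_le_pow_right (Finset.le_sup hi) hy)
    intro i hi
    have hcard : (s.erase i).card = N := by rw [Finset.card_erase_of_mem hi, hs]; rfl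
    have hsplit : ∀ y : ι → A, ∑ j ∈ s, c j * y j ^ p
        = c i * y i ^ p + ∑ j ∈ s.erase i, c j * y j ^ p := fun y =>
      (Finset.add_sum_erase s (fun j => c j * y j ^ p) hi).symm
    have hind' : ∀ y : ι → A, ∑ j ∈ s.erase i, c j * y j ^ p = 0 → ∀ j ∈ s.erase i, y j = 0 := by
      intro y hy j hj
      have h1 := hind (Function.update y i 0) (by
        rw [hsplit, Function.update_self, zero_pow hp0, mul_zero, zero_add, ← hy]
        refine Finset.sum_congr rfl fun k hk => ?_
        rw [Function.update_of_ne (Finset.ne_of_mem_erase hk)]) j (Finset.mem_of_mem_erase hj)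
      rwa [Function.update_of_ne (Finset.ne_of_mem_erase hj)] at h1
    obtain ⟨e', he'⟩ := ih _ hcard hind'
    by_contra hcon
    push Not at hcon
    -- normalised approximations
    have hz : ∀ e, ∃ z : ι → A, c i + ∑ j ∈ s.erase i, c j * z j ^ p ∈ maximalIdeal A ^ e := by
      intro e
      obtain ⟨y, hy, hyi⟩ := hcon e
      have hu : IsUnit (y i) := by
        by_contra h; exact hyi h
      obtain ⟨u, hu⟩ := hu
      refine ⟨fun j => ↑u⁻¹ * y j, ?_⟩
      rw [hsplit] at hy
      have := Ideal.mul_mem_left _ ((↑u⁻¹ : A) ^ p) hy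
      convert this using 1
      rw [mul_add, Finset.mul_sum]
      congr 1
      · rw [← hu, mul_left_comm, ← mul_pow, Units.inv_mul, one_pow, mul_one]
      · exact Finset.sum_congr rfl fun j _ => by ring
    have hdiff : ∀ z w : ι → A, ∑ j ∈ s.erase i, c j * (z j - w j) ^ p
        = (c i + ∑ j ∈ s.erase i, c j * z j ^ p) - (c i + ∑ j ∈ s.erase i, c j * w j ^ p) := by
      intro z w
      rw [add_sub_add_left_eq_sub, ← Finset.sum_sub_distrib]
      exact Finset.sum_congr rfl fun j _ => by rw [sub_pow_char]; ring
    obtain ⟨z0, hz0⟩ := hz (p * 0 + e')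
    obtain ⟨b, hb⟩ := exists_limit_of_step (R := A) (σ := {j // j ∈ s.erase i})
      (fun n z => c i + ∑ j : {j // j ∈ s.erase i}, c j * z j ^ p ∈ maximalIdeal A ^ (p * n + e')) 0
      (by
        intro n _ z hzn
        obtain ⟨w, hw⟩ := hz (p * (n + 1) + e')
        refine ⟨fun j => w j, fun k => ?_, ?_⟩
        · let z' : ι → A := fun j => if h : j ∈ s.erase i then z ⟨j, h⟩ else 0
          have hz' : ∀ j : {j // j ∈ s.erase i}, z' j = z j := fun j => by
            simp only [z', j.2, dif_pos]
          have hzn' : c i + ∑ j ∈ s.erase i, c j * z' j ^ p ∈ maximalIdeal A ^ (p * n + e') := by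
            rw [← Finset.sum_coe_sort]
            simpa only [hz'] using hzn
          have h1 := he' n (fun j => z' j - w j) (by
            rw [hdiff]
            exact Ideal.sub_mem _ hzn' (Ideal.pow_le_pow_right (by
              have : p * n ≤ p * (n + 1) := Nat.mul_le_mul_left _ (by omega)
              omega) hw)) k k.2
          rw [← hz']; exact h1
        · rw [← Finset.sum_coe_sort] at hw
          exact hw) (fun j => z0 j) (by
            rw [← Finset.sum_coe_sort] at hz0
            exact hz0)
    have hlim : c i + ∑ j : {j // j ∈ s.erase i}, c j * b j ^ p = 0 := by
      refine eq_zero_of_forall_mem_pow _ fun k => ?_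
      obtain ⟨a', h1, h2⟩ := hb k
      have h3 : (c i + ∑ j : {j // j ∈ s.erase i}, c j * a' j ^ p) -
          (c i + ∑ j : {j // j ∈ s.erase i}, c j * b j ^ p) ∈ maximalIdeal A ^ k := by
        rw [add_sub_add_left_eq_sub, ← Finset.sum_sub_distrib]
        refine Ideal.sum_mem _ fun j _ => ?_
        rw [← mul_sub, ← sub_pow_char]
        refine Ideal.mul_mem_left _ _ (Ideal.pow_mem_of_mem _ ?_ _ hp.out.pos)
        simpa using h2 j
      have h4 : c i + ∑ j : {j // j ∈ s.erase i}, c j * a' j ^ p ∈ maximalIdeal A ^ k :=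
        Ideal.pow_le_pow_right (by
          have : k ≤ p * k := Nat.le_mul_of_pos_left _ hp.out.pos
          rw [zero_add]; omega) h1
      have := Ideal.sub_mem _ h4 h3
      rwa [sub_sub_cancel] at this
    let y : ι → A := fun j => if h : j ∈ s.erase i then b ⟨j, h⟩ else 1
    have hy := hind y (by
      rw [hsplit, ← Finset.sum_coe_sort]
      have e1 : y i = 1 := by simp [y]
      have e2 : ∀ j : {j // j ∈ s.erase i}, y j = b j := fun j => by
        simp only [y, j.2, dif_pos]
      simp only [e1, e2, one_pow, mul_one]
      exact hlim) i hi
    simp [y] at hy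

/-- From a nontrivial family of coefficients, a nonzero linear form controlled by
`∑ cᵢ yᵢ ^ p`. -/
lemma ppow_linear_form {A : Type*} [CommRing A] [IsDomain A] [IsDiscreteValuationRing A]
    [IsAdicComplete (maximalIdeal A) A] (p : ℕ) [hp : Fact p.Prime] [CharP A p]
    {ι : Type*} [DecidableEq ι] (c : ι → A) (N : ℕ) : ∀ (s : Finset ι), s.card = N →
    (∃ i ∈ s, c i ≠ 0) →
    ∃ l : ι → A, (∃ i ∈ s, l i ≠ 0) ∧ ∃ e, ∀ m, ∀ y : ι → A,
      ∑ i ∈ s, c i * y i ^ p ∈ maximalIdeal A ^ (p * m + e) →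
      ∑ i ∈ s, l i * y i ∈ maximalIdeal A ^ m := by
  have hp0 : p ≠ 0 := hp.out.ne_zero
  induction N with
  | zero =>
    rintro s hs ⟨i, hi, -⟩
    rw [Finset.card_eq_zero] at hs
    simp [hs] at hi
  | succ N ih =>
    rintro s hs ⟨i0, hi0, hci0⟩
    by_cases hind : ∀ y : ι → A, ∑ i ∈ s, c i * y i ^ p = 0 → ∀ i ∈ s, y i = 0
    · obtain ⟨e, he⟩ := ppow_est p c _ s rfl hind
      refine ⟨Pi.single i0 1, ⟨i0, hi0, by simp⟩, e, fun m y hy => ?_⟩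
      exact Ideal.sum_mem _ fun i hi => Ideal.mul_mem_left _ _ (he m y hy i hi)
    · push Not at hind
      obtain ⟨y, hy, i, hi, hyi⟩ := hind
      have hcard : (s.erase i).card = N := by rw [Finset.card_erase_of_mem hi, hs]; rfl
      have hsplit : ∀ y : ι → A, ∑ j ∈ s, c j * y j ^ p
          = c i * y i ^ p + ∑ j ∈ s.erase i, c j * y j ^ p := fun y =>
        (Finset.add_sum_erase s (fun j => c j * y j ^ p) hi).symm
      have hne : ∃ j ∈ s.erase i, c j ≠ 0 := by
        by_contra hcon
        push Not at hcon
        have h0 : ∑ j ∈ s.erase i, c j * y j ^ p = 0 :=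
          Finset.sum_eq_zero fun j hj => by rw [hcon j hj, zero_mul]
        rw [hsplit, h0, add_zero] at hy
        have hci : c i = 0 := (mul_eq_zero.1 hy).resolve_right (pow_ne_zero _ hyi)
        by_cases h : i0 = i
        · exact hci0 (h ▸ hci)
        · exact hci0 (hcon i0 (Finset.mem_erase.2 ⟨h, hi0⟩))
      obtain ⟨l, ⟨j, hj, hlj⟩, e, he⟩ := ih _ hcard hne
      refine ⟨fun k => if k = i then - ∑ j ∈ s.erase i, l j * y j else l k * y i,
        ⟨j, Finset.mem_of_mem_erase hj, ?_⟩, e, fun m z hz => ?_⟩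
      · beta_reduce
        rw [if_neg (Finset.ne_of_mem_erase hj)]
        exact mul_ne_zero hlj hyi
      · have h1 := he m (fun k => y i * z k - y k * z i) (by
          have : ∑ j ∈ s.erase i, c j * (y i * z j - y j * z i) ^ p
              = y i ^ p * (∑ j ∈ s, c j * z j ^ p) - z i ^ p * (∑ j ∈ s, c j * y j ^ p) := by
            rw [hsplit z, hsplit y, mul_add, mul_add, Finset.mul_sum, Finset.mul_sum]
            have : ∑ j ∈ s.erase i, c j * (y i * z j - y j * z i) ^ p
              = ∑ j ∈ s.erase i, y i ^ p * (c j * z j ^ p)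
                - ∑ j ∈ s.erase i, z i ^ p * (c j * y j ^ p) := by
              rw [← Finset.sum_sub_distrib]
              exact Finset.sum_congr rfl fun j _ => by rw [sub_pow_char]; ring
            rw [this]; ring
          rw [this, hy, mul_zero, sub_zero]
          exact Ideal.mul_mem_left _ _ hz)
        convert h1 using 1
        rw [← Finset.add_sum_erase s _ hi]
        beta_reduce
        rw [if_pos rfl]
        have : ∑ k ∈ s.erase i, (if k = i then - ∑ j ∈ s.erase i, l j * y j else l k * y i) * z k
            = ∑ k ∈ s.erase i, l k * (y i * z k) := by
          refine Finset.sum_congr rfl fun k hk => ?_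
          rw [if_neg (Finset.ne_of_mem_erase hk)]; ring
        rw [this]
        simp only [mul_sub, Finset.sum_sub_distrib]
        rw [neg_mul, Finset.sum_mul]
        have : ∑ k ∈ s.erase i, l k * (y k * z i) = ∑ k ∈ s.erase i, l k * y k * z i :=
          Finset.sum_congr rfl fun k _ => by ring
        rw [this]; ring


lemma derivation_eq_sum_pderiv {A σ N : Type*} [Fintype σ] [CommRing A] [AddCommGroup N]
    [Module A N] [Module (MvPolynomial σ A) N] [IsScalarTower A (MvPolynomial σ A) N]
    (d : Derivation A (MvPolynomial σ A) N) (f : MvPolynomial σ A) :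
    d f = ∑ k, pderiv k f • d (X k) := by
  classical
  induction f using MvPolynomial.induction_on with
  | C c => simp
  | add p q hp hq => simp only [map_add, add_smul, Finset.sum_add_distrib, hp, hq]
  | mul_X p j hp =>
    rw [Derivation.leibniz, hp]
    have : ∀ k : σ, (pderiv k (p * X j) : MvPolynomial σ A) • d (X k)
        = (if k = j then p • d (X j) else 0) + (X j : MvPolynomial σ A) • (pderiv k p • d (X k)) := by
      intro k
      rw [Derivation.leibniz]
      by_cases h : k = j
      · subst h; simp [add_smul, mul_smul]
      · rw [pderiv_X_of_ne (Ne.symm h)]; simp [h, mul_smul]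
    simp only [this, Finset.sum_add_distrib, Finset.smul_sum]
    simp

lemma conormal_split {A σ Loc L : Type*} [Fintype σ] [CommRing A] [CommRing Loc] [CommRing L]
    [Algebra A Loc] [Algebra (MvPolynomial σ A) Loc] [IsScalarTower A (MvPolynomial σ A) Loc]
    [Algebra A L] [Algebra Loc L] [IsScalarTower A Loc L]
    [Algebra.FormallySmooth A Loc] [Algebra.FormallySmooth A L]
    (hsurj : Function.Surjective (algebraMap Loc L)) :
    ∃ y : σ → Loc, (∀ k, y k ∈ RingHom.ker (algebraMap Loc L)) ∧
      ∀ f : MvPolynomial σ A, algebraMap (MvPolynomial σ A) Loc f ∈ RingHom.ker (algebraMap Loc L) →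
      algebraMap (MvPolynomial σ A) Loc f -
      ∑ k, algebraMap (MvPolynomial σ A) Loc (pderiv k f) * y k
        ∈ RingHom.ker (algebraMap Loc L) ^ 2 := by
  classical
  obtain ⟨l, hl⟩ := (Algebra.FormallySmooth.iff_split_injection (R := A) (P := Loc) (A := L)
    hsurj).1 inferInstance
  have hy : ∀ k : σ, ∃ y : RingHom.ker (algebraMap Loc L), (RingHom.ker (algebraMap Loc L)).toCotangent y
      = l (1 ⊗ₜ KaehlerDifferential.D A Loc (algebraMap (MvPolynomial σ A) Loc (X k))) :=
    fun k => Ideal.toCotangent_surjective _ _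
  choose y hy using hy
  refine ⟨fun k => y k, fun k => (y k).2, ?_⟩
  intro f hfM
  have h1 := LinearMap.congr_fun hl ((RingHom.ker (algebraMap Loc L)).toCotangent ⟨_, hfM⟩)
  rw [LinearMap.comp_apply, KaehlerDifferential.kerCotangentToTensor_toCotangent,
      LinearMap.id_apply] at h1
  have h2 : KaehlerDifferential.D A Loc (algebraMap (MvPolynomial σ A) Loc f)
        = ∑ k, algebraMap (MvPolynomial σ A) Loc (pderiv k f) •
          KaehlerDifferential.D A Loc (algebraMap (MvPolynomial σ A) Loc (X k)) := by
    have := derivation_eq_sum_pderiv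
        ((KaehlerDifferential.D A Loc).compAlgebraMap (MvPolynomial σ A)) f
    refine this.trans (Finset.sum_congr rfl fun k _ => ?_)
    exact (algebraMap_smul Loc _ _).symm
  change l (1 ⊗ₜ KaehlerDifferential.D A Loc (algebraMap (MvPolynomial σ A) Loc f)) = _ at h1
  rw [h2, TensorProduct.tmul_sum, map_sum] at h1
  simp only [TensorProduct.tmul_smul, map_smul, ← hy] at h1
  simp only [← map_smul, ← map_sum] at h1
  have h3 := (Ideal.toCotangent_eq _).1 h1.symm
  simpa [Algebra.smul_def] using h3

lemma goodIdeal_of_local {A σ : Type*} [Fintype σ] [CommRing A] [IsNoetherianRing A]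
    (P : Ideal (MvPolynomial σ A)) [P.IsPrime] (s : MvPolynomial σ A) (hsP : s ∉ P)
    (m : σ → MvPolynomial σ A) (hmP : ∀ k, m k ∈ P)
    (hφ : ∀ f ∈ P, ∃ s' ∉ P, s' * (s * f - ∑ k, pderiv k f * m k) ∈ P ^ 2) :
    ∃ h ∈ goodIdeal P, h ∉ P := by
  classical
  let φ : MvPolynomial σ A → MvPolynomial σ A := fun f => s * f - ∑ k, pderiv k f * m k
  choose! s' hs' hs'2 using hφ
  obtain ⟨G, hG⟩ := (isNoetherianRing_iff_ideal_fg _).1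
    (inferInstance : IsNoetherianRing (MvPolynomial σ A)) P
  let S := ∏ f ∈ G, s' f
  have hGP : ∀ f ∈ G, f ∈ P := fun f hf => hG ▸ Ideal.subset_span hf
  have hS : S ∉ P := by
    intro hcon
    obtain ⟨f, hf, hf'⟩ := (Ideal.IsPrime.prod_mem_iff (p := P)).1 hcon
    exact hs' f (hGP f hf) hf'
  have hall : ∀ f ∈ P, f ∈ P ∧ S * φ f ∈ P ^ 2 := by
    intro f hf
    have hf' : f ∈ Submodule.span (MvPolynomial σ A) (G : Set (MvPolynomial σ A)) := by
      rw [← hG] at hf; exact hf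
    induction hf' using Submodule.span_induction with
    | mem f hfG =>
      refine ⟨hf, ?_⟩
      obtain ⟨c, hc⟩ : s' f ∣ S := Finset.dvd_prod_of_mem _ hfG
      rw [hc, mul_comm (s' f), mul_assoc]
      exact Ideal.mul_mem_left _ _ (hs'2 f hf)
    | zero => simp [φ]
    | add f g hf1 hg1 ihf ihg =>
      have hfP : f ∈ P := by rw [← hG]; exact hf1
      have hgP : g ∈ P := by rw [← hG]; exact hg1
      refine ⟨hf, ?_⟩
      have : S * φ (f + g) = S * φ f + S * φ g := by
        simp only [φ, map_add, add_mul, Finset.sum_add_distrib]; ring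
      rw [this]; exact Ideal.add_mem _ (ihf hfP).2 (ihg hgP).2
    | smul c f hf1 ihf =>
      have hfP : f ∈ P := by rw [← hG]; exact hf1
      refine ⟨hf, ?_⟩
      have : S * φ (c • f) = c * (S * φ f) - S * (f * ∑ k, pderiv k c * m k) := by
        simp only [φ, smul_eq_mul, Derivation.leibniz, add_mul, Finset.sum_add_distrib,
          Finset.mul_sum, mul_sub]
        have e1 : ∑ k, S * (c * pderiv k f * m k) = ∑ k, c * (S * (pderiv k f * m k)) :=
          Finset.sum_congr rfl fun k _ => by ring
        have e2 : ∑ k, S * (f * pderiv k c * m k) = ∑ k, S * (f * (pderiv k c * m k)) :=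
          Finset.sum_congr rfl fun k _ => by ring
        rw [mul_add, Finset.mul_sum, Finset.mul_sum, e1, e2]
        ring
      rw [this]
      refine Ideal.sub_mem _ (Ideal.mul_mem_left _ _ (ihf hfP).2) (Ideal.mul_mem_left _ _ ?_)
      rw [pow_two]
      exact Ideal.mul_mem_mul hfP (Ideal.sum_mem _ fun k _ => Ideal.mul_mem_left _ _ (hmP k))
  refine ⟨S * s, ⟨fun k => S * m k, fun k => Ideal.mul_mem_left _ _ (hmP k), fun f hf => ?_⟩, ?_⟩
  · have : S * s * f - ∑ k, pderiv k f * (S * m k) = S * φ f := by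
      simp only [φ, mul_sub, Finset.mul_sum]
      congr 1
      · ring
      · exact Finset.sum_congr rfl fun k _ => by ring
    rw [this]; exact (hall f hf).2
  · intro hcon
    rcases (inferInstance : P.IsPrime).mem_or_mem hcon with h | h
    · exact hS h
    · exact hsP h

lemma exists_goodIdeal_not_mem_aux {A σ Loc : Type*} [Fintype σ] [CommRing A] [IsNoetherianRing A]
    (P : Ideal (MvPolynomial σ A)) [P.IsPrime] [CommRing Loc] [Algebra (MvPolynomial σ A) Loc]
    [IsLocalization.AtPrime Loc P] [IsLocalRing Loc] (y : σ → Loc)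
    (hy : ∀ k, y k ∈ maximalIdeal Loc)
    (key : ∀ f ∈ P, algebraMap (MvPolynomial σ A) Loc f -
      ∑ k, algebraMap (MvPolynomial σ A) Loc (pderiv k f) * y k ∈ maximalIdeal Loc ^ 2) :
    ∃ h ∈ goodIdeal P, h ∉ P := by
  classical
  have hMP : maximalIdeal Loc = P.map (algebraMap (MvPolynomial σ A) Loc) := 
    (IsLocalization.AtPrime.map_eq_maximalIdeal P Loc).symm
  obtain ⟨s, hs⟩ := IsLocalization.exist_integer_multiples_of_finset P.primeCompl
    (Finset.univ.image fun k => y k)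
  have hm : ∀ k, ∃ m : MvPolynomial σ A, algebraMap (MvPolynomial σ A) Loc m
      = algebraMap (MvPolynomial σ A) Loc s * y k := by
    intro k
    obtain ⟨m, hm⟩ := hs (y k) (Finset.mem_image_of_mem _ (Finset.mem_univ k))
    refine ⟨m, ?_⟩
    rw [hm, Algebra.smul_def]
  choose m hm using hm
  have hmP : ∀ k, m k ∈ P := by
    intro k
    have h1 : algebraMap (MvPolynomial σ A) Loc (m k) ∈ maximalIdeal Loc := by
      rw [hm k]; exact Ideal.mul_mem_left _ _ (hy k)
    exact (IsLocalization.AtPrime.to_map_mem_maximal_iff Loc P (m k)).1 h1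
  refine goodIdeal_of_local P s s.2 m hmP ?_
  intro f hf
  have h1 : algebraMap (MvPolynomial σ A) Loc (s * f - ∑ k, pderiv k f * m k) ∈
        (P ^ 2).map (algebraMap (MvPolynomial σ A) Loc) := by
      rw [Ideal.map_pow, ← hMP]
      have := Ideal.mul_mem_left _ (algebraMap (MvPolynomial σ A) Loc s) (key f hf)
      convert this using 1
      simp only [map_sub, map_mul, map_sum, hm, mul_sub, Finset.mul_sum]
      congr 1
      exact Finset.sum_congr rfl fun k _ => by ring
  obtain ⟨s', hs', h2⟩ := (IsLocalization.algebraMap_mem_map_algebraMap_iff P.primeCompl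
      Loc (P ^ 2) _).1 h1
  exact ⟨s', hs', h2⟩

/-- If the residue field at `P` is formally smooth over the base, the generic conormal
sequence is split injective. -/
lemma exists_goodIdeal_not_mem {A σ : Type*} [Fintype σ] [CommRing A] [IsNoetherianRing A]
    (P : Ideal (MvPolynomial σ A)) [P.IsPrime] [Algebra.FormallySmooth A P.ResidueField] :
    ∃ h ∈ goodIdeal P, h ∉ P := by
  have hs1 : Algebra.FormallySmooth (MvPolynomial σ A) (Localization.AtPrime P) :=
    .of_isLocalization P.primeCompl
  have hs2 : Algebra.FormallySmooth A (Localization.AtPrime P) := .comp A (MvPolynomial σ A) _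
  have hsurj : Function.Surjective (algebraMap (Localization.AtPrime P) P.ResidueField) :=
    IsLocalRing.residue_surjective
  obtain ⟨y, hy, hy2⟩ := conormal_split (A := A) (σ := σ) hsurj
  have hker : RingHom.ker (algebraMap (Localization.AtPrime P) P.ResidueField)
    = maximalIdeal (Localization.AtPrime P) := IsLocalRing.ker_residue
  rw [hker] at hy2
  simp only [hker] at hy
  refine exists_goodIdeal_not_mem_aux P y hy fun f hf => hy2 f ?_
  exact (IsLocalization.AtPrime.to_map_mem_maximal_iff _ P f).2 hf


lemma smooth_or_pdep {A σ : Type*} [Finite σ] [CommRing A] [IsDomain A]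
    (P : Ideal (MvPolynomial σ A)) [P.IsPrime] (hP : ∀ x : A, C x ∈ P → x = 0) :
    Algebra.FormallySmooth A P.ResidueField ∨ ∃ p : ℕ, p.Prime ∧ CharP A p ∧
      ∃ (s : Finset P.ResidueField) (G : P.ResidueField → MvPolynomial σ A)
        (c : P.ResidueField → A), (∃ i ∈ s, c i ≠ 0) ∧ ∑ i ∈ s, C (c i) * G i ^ p ∈ P ∧
        ∀ l : P.ResidueField → A, ∑ i ∈ s, C (l i) * G i ∈ P → ∀ i ∈ s, l i = 0 := by
  classical
  have hmem : ∀ f : MvPolynomial σ A, algebraMap _ P.ResidueField f = 0 ↔ f ∈ P := fun f =>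
    Ideal.algebraMap_residueField_eq_zero
  have hinj : Function.Injective (algebraMap A P.ResidueField) := by
    rw [injective_iff_map_eq_zero]
    intro x hx
    rw [IsScalarTower.algebraMap_apply A (MvPolynomial σ A), hmem] at hx
    exact hP x hx
  have : FaithfulSMul A P.ResidueField := (faithfulSMul_iff_algebraMap_injective _ _).2 hinj
  let _ : Algebra (FractionRing A) P.ResidueField := FractionRing.liftAlgebra A P.ResidueField
  have : Algebra.EssFiniteType A P.ResidueField := by
    have : Algebra.EssFiniteType (MvPolynomial σ A) P.ResidueField := inferInstance
    exact Algebra.EssFiniteType.comp A (MvPolynomial σ A) _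
  have : Algebra.EssFiniteType (FractionRing A) P.ResidueField :=
    Algebra.EssFiniteType.of_comp A _ _
  have hKs : Algebra.FormallySmooth A (FractionRing A) := .of_isLocalization (nonZeroDivisors A)
  obtain ⟨p, hp⟩ := CharP.exists A
  have hpK : CharP (FractionRing A) p := inferInstance
  rcases CharP.char_is_prime_or_zero A p with hpp | rfl
  swap
  · left
    have : CharZero (FractionRing A) := CharP.charP_to_charZero _
    have : Algebra.FormallySmooth (FractionRing A) P.ResidueField := inferInstance
    exact .comp A (FractionRing A) _
  by_cases H : ∀ s : Finset P.ResidueField, LinearIndepOn (FractionRing A) id (s : Set P.ResidueField) →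
    LinearIndepOn (FractionRing A) (· ^ p) (s : Set P.ResidueField)
  · left
    have hpL : CharP P.ResidueField p := charP_of_injective_algebraMap hinj p
    have : ExpChar (FractionRing A) p := .prime hpp
    obtain ⟨s, hs, H⟩ := exists_isTranscendenceBasis_and_isSeparable_of_linearIndepOn_pow_of_essFiniteType p hpp H
    have : Algebra.IsSeparable (↥(IntermediateField.adjoin (FractionRing A) (Set.range ((↑) : s → P.ResidueField)))) P.ResidueField := by
      rw [show Set.range ((↑) : s → P.ResidueField) = (s : Set P.ResidueField) by simp]; exact H
    have : Algebra.FormallySmooth (FractionRing A) P.ResidueField := 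
      .of_algebraicIndependent_of_isSeparable hs.1
    exact .comp A (FractionRing A) _
  · right
    push Not at H
    obtain ⟨s, hs1, hs2⟩ := H
    refine ⟨p, hpp, hp, s, ?_⟩
    rw [linearIndepOn_finset_iff] at hs1 hs2
    push Not at hs2
    obtain ⟨c, hc0, i, hi, hci⟩ := hs2
    obtain ⟨q, hq⟩ := IsLocalization.exist_integer_multiples_of_finset
      (nonZeroDivisors (MvPolynomial σ A ⧸ P)) s
    have hG : ∀ i : P.ResidueField, ∃ G : MvPolynomial σ A, i ∈ s → algebraMap _ P.ResidueField G
        = algebraMap _ P.ResidueField (q : MvPolynomial σ A ⧸ P) * i := by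
      intro i
      by_cases hi : i ∈ s
      · obtain ⟨g, hg⟩ := hq i hi
        obtain ⟨G, rfl⟩ := Ideal.Quotient.mk_surjective g
        refine ⟨G, fun _ => ?_⟩
        rw [Algebra.smul_def] at hg
        rw [← hg]; rfl
      · exact ⟨0, fun h => absurd h hi⟩
    choose G hG using hG
    have hq0 : algebraMap _ P.ResidueField (q : MvPolynomial σ A ⧸ P) ≠ 0 :=
      IsFractionRing.to_map_ne_zero_of_mem_nonZeroDivisors q.2
    obtain ⟨w, hw⟩ := IsLocalization.exist_integer_multiples_of_finset
      (nonZeroDivisors A) (s.image c)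
    have hw' : ∀ i, ∃ c' : A, i ∈ s → algebraMap _ (FractionRing A) c'
        = algebraMap _ (FractionRing A) (w : A) * c i := by
      intro i
      by_cases hi : i ∈ s
      · obtain ⟨g, hg⟩ := hw (c i) (Finset.mem_image_of_mem _ hi)
        refine ⟨g, fun _ => ?_⟩
        rw [hg, Algebra.smul_def]
      · exact ⟨0, fun h => absurd h hi⟩
    choose c' hc' using hw'
    have hw0 : algebraMap _ (FractionRing A) (w : A) ≠ 0 :=
      IsFractionRing.to_map_ne_zero_of_mem_nonZeroDivisors w.2
    have hCC : ∀ x : A, algebraMap (MvPolynomial σ A) P.ResidueField (C x) =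
        algebraMap (FractionRing A) P.ResidueField (algebraMap A (FractionRing A) x) := by
      intro x
      rw [← IsScalarTower.algebraMap_apply A (FractionRing A) P.ResidueField,
        IsScalarTower.algebraMap_apply A (MvPolynomial σ A) P.ResidueField]
      rfl
    refine ⟨G, c', ⟨i, hi, ?_⟩, ?_, ?_⟩
    · intro h
      have := hc' i hi
      rw [h, map_zero] at this
      exact mul_ne_zero hw0 hci this.symm
    · rw [← hmem, map_sum]
      simp only [map_mul, map_pow, hCC]
      have : ∀ i ∈ s, algebraMap (FractionRing A) P.ResidueField (algebraMap A (FractionRing A) (c' i)) *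
          (algebraMap (MvPolynomial σ A) P.ResidueField (G i)) ^ p
          = (algebraMap (FractionRing A) P.ResidueField (algebraMap A (FractionRing A) w) *
            algebraMap _ P.ResidueField (q : MvPolynomial σ A ⧸ P) ^ p) * (c i • i ^ p) := by
        intro i hi
        rw [hc' i hi, hG i hi, map_mul, Algebra.smul_def]; ring
      rw [Finset.sum_congr rfl this, ← Finset.mul_sum, hc0, mul_zero]
    · intro l hl i hi
      rw [← hmem, map_sum] at hl
      simp only [map_mul, hCC] at hl
      have h2 : ∑ i ∈ s, algebraMap A (FractionRing A) (l i) • id i = 0 := by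
        have : ∀ i ∈ s, algebraMap (FractionRing A) P.ResidueField (algebraMap A (FractionRing A) (l i)) *
          (algebraMap (MvPolynomial σ A) P.ResidueField (G i)) =
            algebraMap _ P.ResidueField (q : MvPolynomial σ A ⧸ P) *
              (algebraMap A (FractionRing A) (l i) • id i) := by
          intro i hi
          rw [hG i hi, Algebra.smul_def, id]; ring
        rw [Finset.sum_congr rfl this, ← Finset.mul_sum] at hl
        exact (mul_eq_zero.1 hl).resolve_left hq0
      have := hs1 _ h2 i hi
      exact (FaithfulSMul.algebraMap_injective A (FractionRing A)) (this.trans (map_zero _).symm)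


lemma dvr_mul_mem_pow {A : Type*} [CommRing A] [IsDomain A] [IsDiscreteValuationRing A]
    (k : ℕ) (f g : A) (h : f * g ∈ maximalIdeal A ^ (2 * k)) :
    f ∈ maximalIdeal A ^ k ∨ g ∈ maximalIdeal A ^ k := by
  obtain ⟨x, hx⟩ := IsDiscreteValuationRing.exists_irreducible A
  rw [dvr_mem_pow_iff hx] at *
  rw [dvr_mem_pow_iff hx]
  by_contra hcon
  push Not at hcon
  obtain ⟨h1, h2⟩ := hcon
  obtain ⟨u, hu⟩ := (ValuationRing.dvd_total (x ^ k) f).resolve_left h1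
  obtain ⟨v, hv⟩ := (ValuationRing.dvd_total (x ^ k) g).resolve_left h2
  obtain ⟨w, hw⟩ := h
  have hx0 : x ^ (2 * k) ≠ 0 := pow_ne_zero _ hx.ne_zero
  have : x ^ (2 * k) * (w * v * u) = x ^ (2 * k) * 1 := by
    calc x ^ (2 * k) * (w * v * u) = (x ^ (2 * k) * w) * v * u := by ring
      _ = (f * u) * (g * v) := by rw [← hw]; ring
      _ = x ^ (2 * k) * 1 := by rw [← hu, ← hv]; ring
  have h3 := mul_left_cancel₀ hx0 this
  have hu' : u * (w * v) = 1 := by rw [← h3]; ring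
  exact h1 ⟨w * v, by rw [hu, mul_assoc, hu', mul_one]⟩

def HasGB {A σ : Type*} [CommRing A] [IsLocalRing A] (I : Ideal (MvPolynomial σ A)) : Prop :=
  ∃ c e : ℕ, ∀ (n : ℕ) (a : σ → A), (∀ p ∈ I, eval a p ∈ maximalIdeal A ^ (c * n + e)) →
    ∃ b : σ → A, (∀ p ∈ I, eval b p = 0) ∧ ∀ k, a k - b k ∈ maximalIdeal A ^ n

lemma eval_mem_sup_span {A σ : Type*} [CommRing A] (I : Ideal (MvPolynomial σ A))
    (h : MvPolynomial σ A) (a : σ → A) (M : Ideal A) (hI : ∀ p ∈ I, eval a p ∈ M)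
    (hh : eval a h ∈ M) : ∀ p ∈ I ⊔ Ideal.span {h}, eval a p ∈ M := by
  have : I ⊔ Ideal.span {h} ≤ M.comap (eval a) :=
    sup_le hI ((Ideal.span_singleton_le_iff_mem _).2 hh)
  exact fun p hp => this hp

lemma lt_sup_span {B : Type*} [CommRing B] (I : Ideal B) (h : B) (hh : h ∉ I) :
    I < I ⊔ Ideal.span {h} :=
  lt_of_le_of_ne le_sup_left fun he => hh (by
    rw [he]; exact Ideal.mem_sup_right (Ideal.mem_span_singleton_self h))

lemma hasGB_smooth {A σ : Type*} [Fintype σ] [CommRing A] [IsDomain A] [IsDiscreteValuationRing A]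
    [IsAdicComplete (maximalIdeal A) A] (I : Ideal (MvPolynomial σ A))
    (h : MvPolynomial σ A) (hgood : h ∈ goodIdeal I) (IH : HasGB (I ⊔ Ideal.span {h})) :
    HasGB I := by
  obtain ⟨c, e, hce⟩ := IH
  refine ⟨2 * c + 1, 2 * e + 1, fun n a ha => ?_⟩
  by_cases hk : eval a h ∈ maximalIdeal A ^ (c * n + e)
  · obtain ⟨b, hb, hb2⟩ := hce n a (eval_mem_sup_span _ _ _ _
        (fun p hp => Ideal.pow_le_pow_right (by nlinarith) (ha p hp)) hk)
    exact ⟨b, fun p hp => hb p (Ideal.mem_sup_left hp), hb2⟩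
  · have ht0 : eval a h ≠ 0 := fun h0 => hk (by rw [h0]; exact zero_mem _)
    have hle : maximalIdeal A ^ (c * n + e) ≤ Ideal.span {eval a h} := by
      obtain ⟨x, hx⟩ := IsDiscreteValuationRing.exists_irreducible A
      rw [dvr_mem_pow_iff hx] at hk
      rw [hx.maximalIdeal_eq, Ideal.span_singleton_pow, Ideal.span_singleton_le_span_singleton]
      exact (ValuationRing.dvd_total _ _).resolve_left hk
    have hle2 : maximalIdeal A ^ ((2 * c + 1) * n + (2 * e + 1)) ≤
        Ideal.span {eval a h ^ 2} * maximalIdeal A ^ (n + 1) := by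
      rw [show (2 * c + 1) * n + (2 * e + 1) = (c * n + e) * 2 + (n + 1) by ring, pow_add,
        pow_mul, ← Ideal.span_singleton_pow]
      exact Ideal.mul_mono_left (Ideal.pow_right_mono hle 2)
    obtain ⟨b, hb1, hb2⟩ := newton ⊥ I (eval a h) 2 (n + 1) le_rfl (by omega)
      (by
        intro y hy
        rw [Ideal.mem_bot] at *
        have := (mul_eq_zero.1 hy).resolve_left (pow_ne_zero _ ht0)
        rw [this, mul_zero]) a h hgood rfl
      (fun p hp => Ideal.mem_sup_right (hle2 (ha p hp)))
    refine ⟨b, fun p hp => hb2 p hp, fun k => ?_⟩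
    have h1 : a k - b k ∈ maximalIdeal A ^ (n + 1) := by
      have h2 : Ideal.span {eval a h} * maximalIdeal A ^ (n + 1) ≤ maximalIdeal A ^ (n + 1) :=
        Ideal.mul_le_right
      have h3 := hb1 k
      exact h2 h3
    exact Ideal.pow_le_pow_right (Nat.le_succ n) h1

lemma hasGB_pdep {A σ : Type*} [Fintype σ] [CommRing A] [IsDomain A] [IsDiscreteValuationRing A]
    [IsAdicComplete (maximalIdeal A) A] (I : Ideal (MvPolynomial σ A))
    (p : ℕ) (hp : p.Prime) [CharP A p] {ι : Type*} (s : Finset ι) (G : ι → MvPolynomial σ A)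
    (c : ι → A) (hc0 : ∃ i ∈ s, c i ≠ 0) (hc : ∑ i ∈ s, C (c i) * G i ^ p ∈ I)
    (hl : ∀ l : ι → A, ∑ i ∈ s, C (l i) * G i ∈ I → ∀ i ∈ s, l i = 0)
    (IH : ∀ J, I < J → HasGB J) :
    HasGB I := by
  classical
  have : Fact p.Prime := ⟨hp⟩
  obtain ⟨l, ⟨i, hi, hli⟩, e, hle⟩ := ppow_linear_form (p := p) c s.card s rfl hc0
  obtain ⟨c', e', hce⟩ := IH _ (lt_sup_span I (∑ i ∈ s, C (l i) * G i)
    (fun hcon => hli (hl l hcon i hi)))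
  refine ⟨p * c', p * e' + e, fun n a ha => ?_⟩
  have h1 : ∑ i ∈ s, l i * eval a (G i) ∈ maximalIdeal A ^ (c' * n + e') := by
    refine hle _ _ ?_
    have := ha _ hc
    simp only [map_sum, map_mul, eval_C, map_pow] at this
    rwa [show p * (c' * n + e') + e = p * c' * n + (p * e' + e) by ring]
  have hp1 := hp.one_le
  obtain ⟨b, hb, hb2⟩ := hce n a (eval_mem_sup_span _ _ _ _
        (fun p' hp' => Ideal.pow_le_pow_right
          (by nlinarith [Nat.zero_le (c' * n), Nat.zero_le e']) (ha p' hp'))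
        (by simpa only [map_sum, map_mul, eval_C] using h1))
  exact ⟨b, fun p hp => hb p (Ideal.mem_sup_left hp), hb2⟩

lemma hasGB_dvr {A σ : Type*} [Fintype σ] [CommRing A] [IsDomain A] [IsDiscreteValuationRing A]
    [IsAdicComplete (maximalIdeal A) A] (I : Ideal (MvPolynomial σ A)) : HasGB I := by
  classical
  induction I using IsNoetherian.induction with
  | hgt I IH =>
  by_cases hprime : Ideal.IsPrime I
  swap
  · rw [Ideal.not_isPrime_iff] at hprime
    rcases hprime with rfl | ⟨f, hf, g, hg, hfg⟩
    · refine ⟨0, 1, fun n a h => ?_⟩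
      have := h 1 trivial
      simp at this
    · obtain ⟨c1, e1, h1⟩ := IH _ (lt_sup_span I f hf)
      obtain ⟨c2, e2, h2⟩ := IH _ (lt_sup_span I g hg)
      refine ⟨2 * (c1 + c2), 2 * (e1 + e2), fun n a h => ?_⟩
      have hfg' := h _ hfg
      rw [map_mul, show 2 * (c1 + c2) * n + 2 * (e1 + e2) = 2 * ((c1 + c2) * n + (e1 + e2)) by ring]
        at hfg'
      rcases dvr_mul_mem_pow _ _ _ hfg' with h3 | h3
      · obtain ⟨b, hb, hb2⟩ := h1 n a (eval_mem_sup_span _ _ _ _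
          (fun p hp => Ideal.pow_le_pow_right (by nlinarith) (h p hp))
          (Ideal.pow_le_pow_right (by nlinarith) h3))
        exact ⟨b, fun p hp => hb p (Ideal.mem_sup_left hp), hb2⟩
      · obtain ⟨b, hb, hb2⟩ := h2 n a (eval_mem_sup_span _ _ _ _
          (fun p hp => Ideal.pow_le_pow_right (by nlinarith) (h p hp))
          (Ideal.pow_le_pow_right (by nlinarith) h3))
        exact ⟨b, fun p hp => hb p (Ideal.mem_sup_left hp), hb2⟩
  by_cases hP : ∀ x : A, C x ∈ I → x = 0
  swap
  · push Not at hP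
    obtain ⟨y, hy, hy0⟩ := hP
    obtain ⟨N, hN⟩ : ∃ N, y ∉ maximalIdeal A ^ N := by
      by_contra hcon
      push Not at hcon
      exact hy0 (eq_zero_of_forall_mem_pow _ hcon)
    refine ⟨0, N, fun n a h => ?_⟩
    have := h _ hy
    simp at this
    exact absurd this hN
  rcases smooth_or_pdep I hP with hs | ⟨p, hp, hpA, s, G, c, hc0, hc, hl⟩
  · obtain ⟨h, hgood, hI⟩ := exists_goodIdeal_not_mem I
    exact hasGB_smooth I h hgood (IH _ (lt_sup_span I h hI))
  · exact hasGB_pdep I p hp s G c hc0 hc hl IH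


lemma mem_sq_of_pderiv_mem {F κ : Type*} [Field F] [PerfectField F] [Field κ] [Algebra F κ]
    (x : MvPolynomial κ F) (hx : aeval (id : κ → κ) x = 0)
    (hd : ∀ k, aeval (id : κ → κ) (pderiv k x) = 0) :
    x ∈ RingHom.ker (aeval (R := F) (id : κ → κ)) ^ 2 := by
  classical
  obtain ⟨s, x', rfl⟩ := exists_finset_rename x
  set I := RingHom.ker (aeval (R := F) (id : κ → κ)) with hI
  let P' : Ideal (MvPolynomial s F) := RingHom.ker (aeval (R := F) ((↑) : s → κ))
  have hP' : P'.IsPrime := RingHom.ker_isPrime _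
  have hren : ∀ y : MvPolynomial s F, aeval (R := F) (id : κ → κ) (rename (↑) y)
      = aeval (R := F) ((↑) : s → κ) y := by
    intro y; rw [aeval_rename]; rfl
  have : Algebra.EssFiniteType F P'.ResidueField :=
    Algebra.EssFiniteType.comp F (MvPolynomial s F) _
  obtain ⟨h, ⟨m, hm, hgood⟩, hh⟩ := exists_goodIdeal_not_mem P'
  have hx' : x' ∈ P' := by
    rw [hren] at hx; exact hx
  have h1 : h * x' ∈ P' ^ 2 := by
    have h2 := hgood x' hx'
    have h3 : ∑ k, pderiv k x' * m k ∈ P' ^ 2 := by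
      refine Ideal.sum_mem _ fun k _ => ?_
      rw [pow_two]
      refine Ideal.mul_mem_mul ?_ (hm k)
      have := hd k
      rw [pderiv_rename Subtype.val_injective, hren] at this
      exact this
    have := Ideal.add_mem _ h2 h3
    simpa using this
  have hmap : P'.map (rename (R := F) ((↑) : s → κ)) ≤ I := by
    rw [Ideal.map_le_iff_le_comap]
    intro y hy
    change aeval (R := F) (id : κ → κ) (rename (↑) y) = 0
    rw [hren]; exact hy
  have h4 : rename (↑) h * rename (↑) x' ∈ I ^ 2 := by
    have h5 := Ideal.mem_map_of_mem (rename (R := F) ((↑) : s → κ)) h1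
    rw [Ideal.map_pow, map_mul] at h5
    exact Ideal.pow_right_mono hmap 2 h5
  have h6 : aeval (R := F) (id : κ → κ) (rename (↑) h) ≠ 0 := by
    rw [hren]; exact hh
  set z := aeval (R := F) (id : κ → κ) (rename (↑) h)
  have h7 : X z⁻¹ * rename (↑) h - 1 ∈ I := by
    change aeval (R := F) (id : κ → κ) _ = 0
    rw [map_sub, map_mul, map_one, aeval_X]
    change z⁻¹ * z - 1 = 0
    rw [inv_mul_cancel₀ h6, sub_self]
  have h8 : rename (↑) x' ∈ I := hx
  have : rename (↑) x' = X z⁻¹ * (rename (↑) h * rename (↑) x')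
    - (X z⁻¹ * rename (↑) h - 1) * rename (↑) x' := by ring
  rw [this]
  refine Ideal.sub_mem _ (Ideal.mul_mem_left _ _ h4) ?_
  rw [pow_two]; exact Ideal.mul_mem_mul h7 h8

lemma formallySmooth_of_perfect (F κ : Type*) [Field F] [PerfectField F] [Field κ] [Algebra F κ] :
    Algebra.FormallySmooth F κ := by
  let _ : Algebra (MvPolynomial κ F) κ := (aeval (R := F) (id : κ → κ)).toAlgebra
  have hal : ∀ x, algebraMap (MvPolynomial κ F) κ x = aeval (R := F) (id : κ → κ) x := fun x => rfl
  have : IsScalarTower F (MvPolynomial κ F) κ := IsScalarTower.of_algebraMap_eq fun x => by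
    rw [hal]; simp [MvPolynomial.algebraMap_eq]
  have hsurj : Function.Surjective (algebraMap (MvPolynomial κ F) κ) := fun z =>
    ⟨X z, by rw [hal, aeval_X]; rfl⟩
  rw [Algebra.formallySmooth_iff]
  refine ⟨inferInstance, ?_⟩
  rw [← Algebra.FormallySmooth.kerCotangentToTensor_injective_iff (P := MvPolynomial κ F) hsurj,
    injective_iff_map_eq_zero]
  intro y hy
  obtain ⟨⟨x, hx⟩, rfl⟩ := Ideal.toCotangent_surjective _ y
  rw [KaehlerDifferential.kerCotangentToTensor_toCotangent] at hy
  rw [Ideal.toCotangent_eq_zero]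
  refine mem_sq_of_pderiv_mem x hx fun k => ?_
  have h1 := congrArg (fun w => TensorProduct.rid (MvPolynomial κ F) κ (LinearMap.lTensor κ
    ((pderiv (R := F) k).liftKaehlerDifferential) w)) hy
  simp only [map_zero] at h1
  change TensorProduct.rid (MvPolynomial κ F) κ (LinearMap.lTensor κ
    ((pderiv (R := F) k).liftKaehlerDifferential) (1 ⊗ₜ KaehlerDifferential.D F _ x)) = 0 at h1
  rw [LinearMap.lTensor_tmul, Derivation.liftKaehlerDifferential_comp_D, TensorProduct.rid_tmul,
    Algebra.smul_def, mul_one] at h1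
  exact h1


lemma exists_section_of_perfect (F R : Type*) [Field F] [PerfectField F] [CommRing R] [IsLocalRing R]
    [IsAdicComplete (maximalIdeal R) R] [Algebra F R] :
    ∃ s : ResidueField R →+* R, ∀ z, residue R (s z) = z := by
  have := formallySmooth_of_perfect F (ResidueField R)
  let f : ResidueField R →ₐ[F] R ⧸ maximalIdeal R :=
    { toRingHom := RingHom.id (ResidueField R), commutes' := fun x => rfl }
  obtain ⟨g, hg⟩ := Algebra.FormallySmooth.exists_mkₐ_comp_eq_of_isAdicComplete f
  exact ⟨g.toRingHom, fun z => DFunLike.congr_fun hg z⟩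

lemma exists_section (K R : Type*) [Field K] [CommRing R] [IsLocalRing R]
    [IsAdicComplete (maximalIdeal R) R] [Algebra K R] :
    ∃ s : ResidueField R →+* R, ∀ z, residue R (s z) = z := by
  obtain ⟨p, hp⟩ := CharP.exists K
  rcases CharP.char_is_prime_or_zero K p with hpp | rfl
  · have : Fact p.Prime := ⟨hpp⟩
    let _ : Algebra (ZMod p) K := ZMod.algebra K p
    let _ : Algebra (ZMod p) R := ((algebraMap K R).comp (algebraMap (ZMod p) K)).toAlgebra
    exact exists_section_of_perfect (ZMod p) R
  · have : CharZero K := CharP.charP_to_charZero _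
    let _ : Algebra ℚ R := ((algebraMap K R).comp (algebraMap ℚ K)).toAlgebra
    exact exists_section_of_perfect ℚ R


lemma eval₂_sub_mem_pow {κ R : Type*} [Field κ] [CommRing R] (m : Ideal R) (s : κ →+* R) (x : R)
    (hx : x ∈ m) (P Q : Polynomial κ) (n : ℕ) (h : ∀ d < n, P.coeff d = Q.coeff d) :
    Polynomial.eval₂ s x P - Polynomial.eval₂ s x Q ∈ m ^ n := by
  have : Polynomial.X ^ n ∣ P - Q := by
    rw [Polynomial.X_pow_dvd_iff]
    intro d hd; rw [Polynomial.coeff_sub, h d hd, sub_self]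
  obtain ⟨T, hT⟩ := this
  rw [← Polynomial.eval₂_sub, hT, Polynomial.eval₂_mul, Polynomial.eval₂_X_pow]
  exact Ideal.mul_mem_right _ _ (Ideal.pow_mem_pow hx n)

lemma exists_powerSeries_hom {κ R : Type*} [Field κ] [CommRing R] (m : Ideal R)
    [IsAdicComplete m R] (s : κ →+* R) (x : R) (hx : x ∈ m) :
    ∃ φ : PowerSeries κ →+* R, ∀ (p : PowerSeries κ) (n : ℕ),
      φ p - Polynomial.eval₂ s x (p.trunc n) ∈ m ^ n := by
  let f : (n : ℕ) → PowerSeries κ →+* R ⧸ m ^ n := fun n =>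
    { toFun := fun p => Ideal.Quotient.mk _ (Polynomial.eval₂ s x (p.trunc n))
      map_one' := by
        rw [← map_one (Ideal.Quotient.mk (m ^ n)), Ideal.Quotient.mk_eq_mk_iff_sub_mem,
          ← Polynomial.eval₂_one s x]
        refine eval₂_sub_mem_pow m s x hx _ _ n fun d hd => ?_
        rw [PowerSeries.coeff_trunc, if_pos hd, PowerSeries.coeff_one, Polynomial.coeff_one]
      map_zero' := by simp
      map_add' := fun p q => by simp
      map_mul' := fun p q => by
        rw [← map_mul, Ideal.Quotient.mk_eq_mk_iff_sub_mem, ← Polynomial.eval₂_mul]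
        refine eval₂_sub_mem_pow m s x hx _ _ n fun d hd => ?_
        rw [PowerSeries.coeff_trunc, if_pos hd,
          PowerSeries.coeff_mul_eq_coeff_trunc_mul_trunc p q hd,
          ← Polynomial.coe_mul, Polynomial.coeff_coe] }
  refine ⟨IsAdicComplete.liftRingHom m f ?_, fun p n => ?_⟩
  · intro k n hle
    ext p
    change Ideal.Quotient.mk _ (Polynomial.eval₂ s x (p.trunc n)) =
      Ideal.Quotient.mk _ (Polynomial.eval₂ s x (p.trunc k))
    rw [Ideal.Quotient.mk_eq_mk_iff_sub_mem]
    refine eval₂_sub_mem_pow m s x hx _ _ k fun d hd => ?_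
    rw [PowerSeries.coeff_trunc, if_pos (by omega), PowerSeries.coeff_trunc, if_pos hd]
  · rw [← Ideal.Quotient.mk_eq_mk_iff_sub_mem, IsAdicComplete.mk_liftRingHom]
    rfl

lemma exists_spanning_mod_pow {R : Type*} [CommRing R] [IsNoetherianRing R] [IsLocalRing R]
    (s : ResidueField R →+* R) (hs : ∀ z, residue R (s z) = z) (k : ℕ) :
    ∃ (g : ℕ) (v : Fin g → R), ∀ r, ∃ c : Fin g → ResidueField R,
      r - ∑ l, s (c l) * v l ∈ maximalIdeal R ^ k := by
  induction k with
  | zero => exact ⟨0, Fin.elim0, fun r => ⟨Fin.elim0, by simp⟩⟩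
  | succ k ih =>
    obtain ⟨g, v, hv⟩ := ih
    obtain ⟨g', u, hu⟩ := Submodule.fg_iff_exists_fin_generating_family.1
      (IsNoetherian.noetherian (maximalIdeal R ^ k))
    refine ⟨g + g', Fin.append v u, fun r => ?_⟩
    obtain ⟨c, hc⟩ := hv r
    rw [← hu] at hc
    obtain ⟨w, hw⟩ := (Submodule.mem_span_range_iff_exists_fun R).1 hc
    refine ⟨Fin.append c fun l => residue R (w l), ?_⟩
    rw [Fin.sum_univ_add]
    simp only [Fin.append_left, Fin.append_right]
    rw [← sub_sub, ← hw, ← Finset.sum_sub_distrib]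
    refine Ideal.sum_mem _ fun l _ => ?_
    rw [smul_eq_mul, ← sub_mul, pow_succ']
    refine Ideal.mul_mem_mul ?_ ?_
    · rw [← residue_eq_zero_iff, map_sub, hs, sub_self]
    · rw [← hu]; exact Submodule.subset_span ⟨l, rfl⟩

lemma exists_spanning_powerSeries {R : Type*} [CommRing R] [IsNoetherianRing R] [IsLocalRing R]
    (s : ResidueField R →+* R) (hs : ∀ z, residue R (s z) = z) (I : Ideal R) (x : R)
    (hx : x ∈ maximalIdeal R) (k : ℕ) (hk : maximalIdeal R ^ k ≤ I ⊔ Ideal.span {x})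
    (φ : PowerSeries (ResidueField R) →+* R)
    (hφ : ∀ (p : PowerSeries (ResidueField R)) (n : ℕ),
      φ p - Polynomial.eval₂ s x (p.trunc n) ∈ maximalIdeal R ^ n) :
    ∃ (g : ℕ) (v : Fin g → R), ∀ r, ∃ c : Fin g → PowerSeries (ResidueField R),
      r - ∑ l, φ (c l) * v l ∈ I := by
  obtain ⟨g, v, hv⟩ := exists_spanning_mod_pow s hs k
  refine ⟨g, v, fun r => ?_⟩
  have step : ∀ r, ∃ (c : Fin g → ResidueField R) (r' : R), r - ∑ l, s (c l) * v l - x * r' ∈ I := by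
    intro r
    obtain ⟨c, hc⟩ := hv r
    obtain ⟨i, hi, y, hy, hiy⟩ := Submodule.mem_sup.1 (hk hc)
    obtain ⟨r', rfl⟩ := Ideal.mem_span_singleton.1 hy
    exact ⟨c, r', by rw [← hiy]; simpa using hi⟩
  choose c nx hc using step
  let rs : ℕ → R := fun n => nx^[n] r
  have hrs : ∀ n, rs (n + 1) = nx (rs n) := fun n => Function.iterate_succ_apply' nx n r
  let α : Fin g → PowerSeries (ResidueField R) := fun l => PowerSeries.mk fun j => c (rs j) l
  refine ⟨α, ?_⟩
  have hn : ∀ n, r - ∑ l, Polynomial.eval₂ s x ((α l).trunc n) * v l - x ^ n * rs n ∈ I := by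
    intro n
    induction n with
    | zero => simp [rs]
    | succ n ih =>
      have h1 := Ideal.mul_mem_left I (x ^ n) (hc (rs n))
      have h2 := I.add_mem ih h1
      convert h2 using 1
      have h3 : ∀ l, Polynomial.eval₂ s x ((α l).trunc (n + 1)) =
          Polynomial.eval₂ s x ((α l).trunc n) + s (c (rs n) l) * x ^ n := by
        intro l
        rw [PowerSeries.trunc_succ, Polynomial.eval₂_add, Polynomial.eval₂_monomial]
        simp [α]
      simp only [h3, add_mul, Finset.sum_add_distrib, hrs, mul_sub, Finset.mul_sum]
      have h4 : ∑ l, s (c (rs n) l) * x ^ n * v l = ∑ l, x ^ n * (s (c (rs n) l) * v l) :=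
        Finset.sum_congr rfl fun l _ => by ring
      rw [h4]; ring
  refine mem_of_forall_mem_sup_pow I _ fun n => ?_
  have h5 : r - ∑ l, φ (α l) * v l =
      (r - ∑ l, Polynomial.eval₂ s x ((α l).trunc n) * v l - x ^ n * rs n) +
      (x ^ n * rs n - ∑ l, (φ (α l) - Polynomial.eval₂ s x ((α l).trunc n)) * v l) := by
    simp only [sub_mul, Finset.sum_sub_distrib]; ring
  rw [h5]
  refine Submodule.add_mem_sup (hn n) (Ideal.sub_mem _ ?_ ?_)
  · exact Ideal.mul_mem_right _ _ (Ideal.pow_mem_pow hx n)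
  · exact Ideal.sum_mem _ fun l _ => Ideal.mul_mem_right _ _ (hφ _ n)


/-- Weil restriction of a polynomial along `A → R / I`, where `R / I` is spanned by `v`. -/
lemma exists_weil {A R σ : Type*} [CommRing A] [CommRing R] (I : Ideal R) (φ : A →+* R) {g : ℕ}
    (v : Fin g → R) (hv : ∀ r, ∃ c : Fin g → A, r - ∑ l, φ (c l) * v l ∈ I)
    (p : MvPolynomial σ R) :
    ∃ F : Fin g → MvPolynomial (σ × Fin g) A, ∀ y : σ × Fin g → A,
      eval (fun j => ∑ l, φ (y (j, l)) * v l) p - ∑ l, φ (eval y (F l)) * v l ∈ I := by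
  induction p using MvPolynomial.induction_on with
  | C r =>
    obtain ⟨c, hc⟩ := hv r
    exact ⟨fun l => C (c l), fun y => by simpa using hc⟩
  | add p q hp hq =>
    obtain ⟨F, hF⟩ := hp
    obtain ⟨G, hG⟩ := hq
    refine ⟨F + G, fun y => ?_⟩
    have := I.add_mem (hF y) (hG y)
    convert this using 1
    simp only [Pi.add_apply, map_add, add_mul, Finset.sum_add_distrib]; ring
  | mul_X p j hp =>
    obtain ⟨F, hF⟩ := hp
    have hγ : ∀ l l' : Fin g, ∃ c : Fin g → A, v l * v l' - ∑ m, φ (c m) * v m ∈ I :=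
      fun l l' => hv _
    choose γ hγ using hγ
    refine ⟨fun m => ∑ l, ∑ l', F l * X (j, l') * C (γ l l' m), fun y => ?_⟩
    have h1 := I.mul_mem_right (∑ l', φ (y (j, l')) * v l') (hF y)
    have h2 : ∑ l, ∑ l', φ (eval y (F l)) * φ (y (j, l')) *
        (v l * v l' - ∑ m, φ (γ l l' m) * v m) ∈ I :=
      Ideal.sum_mem _ fun l _ => Ideal.sum_mem _ fun l' _ => I.mul_mem_left _ (hγ l l')
    have h3 := I.add_mem h1 h2
    convert h3 using 1
    have e1 : ∑ m, φ (eval y (∑ l, ∑ l', F l * X (j, l') * C (γ l l' m))) * v m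
        = ∑ l, ∑ l', φ (eval y (F l)) * φ (y (j, l')) * ∑ m, φ (γ l l' m) * v m := by
      simp only [map_sum, map_mul, eval_X, eval_C, Finset.sum_mul, Finset.mul_sum]
      rw [Finset.sum_comm]
      refine Finset.sum_congr rfl fun l _ => ?_
      rw [Finset.sum_comm]
      refine Finset.sum_congr rfl fun l' _ => Finset.sum_congr rfl fun m _ => by ring
    have e2 : (∑ l, φ (eval y (F l)) * v l) * (∑ l', φ (y (j, l')) * v l')
        = ∑ l, ∑ l', φ (eval y (F l)) * φ (y (j, l')) * (v l * v l') := by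
      rw [Finset.sum_mul_sum]
      refine Finset.sum_congr rfl fun l _ => Finset.sum_congr rfl fun l' _ => by ring
    rw [e1, map_mul, eval_X, sub_mul, e2]
    simp only [mul_sub, Finset.sum_sub_distrib]
    ring

lemma sup_pow_le_sup {R : Type*} [CommRing R] (I J : Ideal R) (n : ℕ) :
    (I ⊔ J) ^ n ≤ I ⊔ J ^ n := by
  induction n with
  | zero => simp
  | succ n ih =>
    rw [pow_succ, pow_succ]
    refine (Ideal.mul_mono_left ih).trans ?_
    rw [Ideal.sup_mul, Ideal.mul_sup, Ideal.mul_sup]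
    exact sup_le (sup_le (Ideal.mul_le_left.trans le_sup_left) (Ideal.mul_le_left.trans le_sup_left))
      (sup_le (Ideal.mul_le_right.trans le_sup_left) le_sup_right)

lemma rel_greenberg_aux {A R σ ι : Type*} [Fintype σ] [Fintype ι]
    [CommRing A] [IsDomain A] [IsDiscreteValuationRing A]
    [IsAdicComplete (maximalIdeal A) A] [CommRing R] [IsLocalRing R]
    (I : Ideal R) (φ : A →+* R) (X0 : A) (hX0 : Irreducible X0)
    (hx : φ X0 ∈ maximalIdeal R) (k : ℕ)
    (hk : maximalIdeal R ^ k ≤ I ⊔ Ideal.span {φ X0}) {g : ℕ}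
    (v : Fin g → R) (hv : ∀ r, ∃ c : Fin g → A, r - ∑ l, φ (c l) * v l ∈ I)
    (f : ι → MvPolynomial σ R) :
    ∃ c e : ℕ, ∀ (n : ℕ) (a : σ → R),
      (∀ i, eval a (f i) ∈ I ⊔ maximalIdeal R ^ (c * n + e)) →
      ∃ b : σ → R, (∀ i, eval b (f i) ∈ I) ∧ ∀ j, a j - b j ∈ maximalIdeal R ^ n := by
  classical
  let Km : Submodule A (Fin g → A) :=
    { carrier := {α | ∑ l, φ (α l) * v l ∈ I}
      zero_mem' := by simp
      add_mem' := fun {α β} hα hβ => by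
        have := I.add_mem hα hβ
        simpa only [Set.mem_ofPred_eq, Pi.add_apply, map_add, add_mul, Finset.sum_add_distrib]
      smul_mem' := fun c α hα => by
        have := I.mul_mem_left (φ c) hα
        simpa only [Set.mem_ofPred_eq, Pi.smul_apply, smul_eq_mul, map_mul, Finset.mul_sum,
          mul_assoc] using this }
  have hKm : ∀ α : Fin g → A, α ∈ Km ↔ ∑ l, φ (α l) * v l ∈ I := fun α => Iff.rfl
  obtain ⟨w, κ, hκ⟩ := Submodule.fg_iff_exists_fin_generating_family.1
    (IsNoetherian.noetherian Km)
  choose F hF using fun i => exists_weil I φ v hv (f i)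
  let E : ι × Fin g → MvPolynomial ((σ × Fin g) ⊕ (ι × Fin w)) A := fun il =>
    rename Sum.inl (F il.1 il.2) - ∑ u, C (κ u il.2) * X (Sum.inr (il.1, u))
  have hE : ∀ (y : (σ × Fin g) ⊕ (ι × Fin w) → A) i l, eval y (E (i, l)) =
      eval (fun jl => y (Sum.inl jl)) (F i l) - ∑ u, κ u l * y (Sum.inr (i, u)) := by
    intro y i l
    simp only [E, map_sub, eval_rename, map_sum, map_mul, eval_C, eval_X]
    rfl
  obtain ⟨c, e, hce⟩ := hasGB_dvr (Ideal.span (Set.range E))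
  refine ⟨k * c, k * e, fun n a ha => ?_⟩
  set M := c * n + e with hM
  have hpow : maximalIdeal R ^ (k * c * n + k * e) ≤ I ⊔ Ideal.span {φ X0 ^ M} := by
    rw [show k * c * n + k * e = k * M by rw [hM]; ring, pow_mul, ← Ideal.span_singleton_pow]
    refine (Ideal.pow_right_mono hk M).trans ?_
    exact sup_pow_le_sup I _ M
  choose y hy using fun j => hv (a j)
  have hz : ∀ i, ∃ z : Fin w → A, ∀ l, X0 ^ M ∣ eval (fun jl : σ × Fin g => y jl.1 jl.2) (F i l)
      - ∑ u, κ u l * z u := by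
    intro i
    have h1 := ha i
    obtain ⟨i0, hi0, r0, hr0, hir⟩ := Submodule.mem_sup.1 ((sup_le le_sup_left hpow :
      I ⊔ maximalIdeal R ^ (k * c * n + k * e) ≤ I ⊔ Ideal.span {φ X0 ^ M}) h1)
    obtain ⟨r, rfl⟩ := Ideal.mem_span_singleton.1 hr0
    obtain ⟨α, hα⟩ := hv r
    have h2 : eval a (f i) - eval (fun j => ∑ l, φ (y j l) * v l) (f i) ∈ I :=
      eval_sub_eval_mem I _ _ hy _
    have h3 := hF i (fun jl => y jl.1 jl.2)
    simp only at h3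
    have h4 : (fun l => eval (fun jl : σ × Fin g => y jl.1 jl.2) (F i l) - X0 ^ M * α l) ∈ Km := by
      rw [hKm]
      have h5 := I.sub_mem (I.add_mem hi0 (I.mul_mem_left (φ X0 ^ M) hα)) (I.add_mem h2 h3)
      convert h5 using 1
      rw [← hir]
      simp only [map_sub, map_mul, map_pow, sub_mul, Finset.sum_sub_distrib, mul_sub,
        Finset.mul_sum, mul_assoc]
      ring
    rw [← hκ] at h4
    obtain ⟨z, hz⟩ := (Submodule.mem_span_range_iff_exists_fun A).1 h4
    refine ⟨z, fun l => ⟨α l, ?_⟩⟩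
    have h6 := congrFun hz l
    simp only [Finset.sum_apply, Pi.smul_apply, smul_eq_mul] at h6
    have h7 : ∑ u, κ u l * z u = ∑ u, z u * κ u l := Finset.sum_congr rfl fun _ _ => mul_comm _ _
    rw [h7, h6]; ring
  choose z hz using hz
  let Y : (σ × Fin g) ⊕ (ι × Fin w) → A := Sum.elim (fun jl => y jl.1 jl.2) (fun iu => z iu.1 iu.2)
  obtain ⟨Y', hY', hYY⟩ := hce n Y (by
    have : Ideal.span (Set.range E) ≤ (maximalIdeal A ^ M).comap (eval Y) := by
      rw [Ideal.span_le]
      rintro _ ⟨⟨i, l⟩, rfl⟩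
      rw [SetLike.mem_coe, Ideal.mem_comap, hE, dvr_mem_pow_iff hX0]
      exact hz i l
    exact fun p hp => this hp)
  refine ⟨fun j => a j - ∑ l, φ (y j l - Y' (Sum.inl (j, l))) * v l, fun i => ?_, fun j => ?_⟩
  · have h1 : eval (fun j => a j - ∑ l, φ (y j l - Y' (Sum.inl (j, l))) * v l) (f i)
        - eval (fun j => ∑ l, φ (Y' (Sum.inl (j, l))) * v l) (f i) ∈ I := by
      refine eval_sub_eval_mem I _ _ (fun j => ?_) _
      convert hy j using 1
      simp only [map_sub, sub_mul, Finset.sum_sub_distrib]; ring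
    have h2 := hF i (fun jl => Y' (Sum.inl jl))
    have h3 : (fun l => eval (fun jl => Y' (Sum.inl jl)) (F i l)) ∈ Km := by
      rw [← hκ, Submodule.mem_span_range_iff_exists_fun]
      refine ⟨fun u => Y' (Sum.inr (i, u)), ?_⟩
      funext l
      have h4 := hY' _ (Ideal.subset_span ⟨(i, l), rfl⟩)
      rw [hE, sub_eq_zero] at h4
      rw [h4]
      simp only [Finset.sum_apply, Pi.smul_apply, smul_eq_mul]
      exact Finset.sum_congr rfl fun _ _ => mul_comm _ _
    rw [hKm] at h3
    have h5 := I.add_mem (I.add_mem h1 h2) h3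
    convert h5 using 1
    ring
  · rw [sub_sub_cancel]
    refine Ideal.sum_mem _ fun l _ => Ideal.mul_mem_right _ _ ?_
    have h1 := hYY (Sum.inl (j, l))
    rw [dvr_mem_pow_iff hX0] at h1
    obtain ⟨q, hq⟩ := h1
    change y j l - Y' (Sum.inl (j, l)) = _ at hq
    rw [hq, map_mul, map_pow]
    exact Ideal.mul_mem_right _ _ (Ideal.pow_mem_pow hx n)

/-- Linear Greenberg approximation modulo an ideal `I` with `dim R / I ≤ 1`. -/
lemma rel_greenberg {R σ ι : Type*} [Fintype σ] [Fintype ι] (K : Type*) [Field K]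
    [CommRing R] [IsNoetherianRing R] [IsLocalRing R] [IsAdicComplete (maximalIdeal R) R]
    [Algebra K R] (I : Ideal R) (x : R) (hx : x ∈ maximalIdeal R) (k : ℕ)
    (hk : maximalIdeal R ^ k ≤ I ⊔ Ideal.span {x}) (f : ι → MvPolynomial σ R) :
    ∃ c e : ℕ, ∀ (n : ℕ) (a : σ → R),
      (∀ i, eval a (f i) ∈ I ⊔ maximalIdeal R ^ (c * n + e)) →
      ∃ b : σ → R, (∀ i, eval b (f i) ∈ I) ∧ ∀ j, a j - b j ∈ maximalIdeal R ^ n := by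
  obtain ⟨s, hs⟩ := exists_section K R
  obtain ⟨φ, hφ⟩ := exists_powerSeries_hom (maximalIdeal R) s x hx
  have hφX : φ PowerSeries.X = x := by
    rw [← sub_eq_zero]
    refine eq_zero_of_forall_mem_pow _ fun n => ?_
    have := hφ PowerSeries.X (n + 2)
    rw [PowerSeries.trunc_X, Polynomial.eval₂_X] at this
    exact Ideal.pow_le_pow_right (by omega) this
  obtain ⟨g, v, hv⟩ := exists_spanning_powerSeries s hs I x hx k hk φ hφ
  have : IsAdicComplete (maximalIdeal (PowerSeries (ResidueField R)))
      (PowerSeries (ResidueField R)) := by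
    rw [PowerSeries.maximalIdeal_eq_span_X]; infer_instance
  exact rel_greenberg_aux I φ PowerSeries.X PowerSeries.X_irreducible (by rwa [hφX]) k
    (by rwa [hφX]) v hv f


lemma nakayama_le {R : Type*} [CommRing R] [IsNoetherianRing R] [IsLocalRing R]
    (T J : Ideal R) (h : T ≤ J ⊔ maximalIdeal R * T) : T ≤ J := by
  refine Submodule.le_of_le_smul_of_le_jacobson_bot (IsNoetherian.noetherian T)
    (I := maximalIdeal R) ?_ (by simpa using h)
  rw [IsLocalRing.jacobson_eq_maximalIdeal _ bot_ne_top]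

lemma map_eval_le {R σ : Type*} [CommRing R] (D : Ideal R) (a b : σ → R)
    (hab : ∀ k, a k - b k ∈ D) (H : Ideal (MvPolynomial σ R)) :
    H.map (eval a) ≤ H.map (eval b) ⊔ D := by
  rw [Ideal.map_le_iff_le_comap]
  intro h hh
  rw [Ideal.mem_comap]
  have : eval a h = eval b h + (eval a h - eval b h) := by ring
  rw [this]
  exact Submodule.add_mem_sup (Ideal.mem_map_of_mem _ hh) (eval_sub_eval_mem D a b hab h)

lemma exists_stable_colon {R : Type*} [CommRing R] [IsNoetherianRing R] (I₀ : Ideal R) (t : R) :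
    ∃ c, 2 ≤ c ∧ ∀ y, t ^ c * y ∈ I₀ → t ^ (c - 1) * y ∈ I₀ := by
  let D : ℕ →o Ideal R :=
    { toFun := fun n => Submodule.comap (LinearMap.mulLeft R (t ^ n)) I₀
      monotone' := by
        intro a b hab y hy
        obtain ⟨d, rfl⟩ := Nat.exists_eq_add_of_le hab
        have h1 : t ^ a * y ∈ I₀ := hy
        change t ^ (a + d) * y ∈ I₀
        rw [add_comm, pow_add, mul_assoc]
        exact I₀.mul_mem_left _ h1 }
  obtain ⟨n, hn⟩ := monotone_stabilizes_iff_noetherian.2 (inferInstance : IsNoetherian R R) D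
  refine ⟨n + 2, by omega, fun y hy => ?_⟩
  have h1 : y ∈ D (n + 2) := hy
  have h2 : D (n + 1) = D (n + 2) := (hn (n + 1) (by omega)).symm.trans (hn (n + 2) (by omega))
  rw [← h2] at h1
  exact h1

lemma artin_rees_rel {R : Type*} [CommRing R] [IsNoetherianRing R] [IsLocalRing R]
    (I₀ : Ideal R) (u : R) : ∃ k, ∀ n, (I₀ ⊔ Ideal.span {u}) ⊓ (I₀ ⊔ maximalIdeal R ^ (n + k)) ≤
      I₀ ⊔ Ideal.span {u} * maximalIdeal R ^ n := by
  obtain ⟨k, hk⟩ := Ideal.exists_pow_inf_eq_pow_smul (maximalIdeal R) (I₀ ⊔ Ideal.span {u})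
  refine ⟨k, fun n => ?_⟩
  rintro z ⟨hz1, hz2⟩
  obtain ⟨i, hi, w, hw, rfl⟩ := Submodule.mem_sup.1 hz2
  have hw1 : w ∈ I₀ ⊔ Ideal.span {u} := by
    have := Ideal.sub_mem _ hz1 (Ideal.mem_sup_left hi : i ∈ I₀ ⊔ Ideal.span {u})
    simpa using this
  have h1 := hk (n + k) (by omega)
  have h2 : w ∈ maximalIdeal R ^ (n + k) • (⊤ : Submodule R R) ⊓ (I₀ ⊔ Ideal.span {u}) :=
    ⟨by simpa using hw, hw1⟩
  rw [h1, Nat.add_sub_cancel] at h2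
  have h3 : w ∈ maximalIdeal R ^ n * (I₀ ⊔ Ideal.span {u}) :=
    (Submodule.smul_mono le_rfl inf_le_right) h2
  rw [Ideal.mul_sup] at h3
  refine Ideal.add_mem _ (Ideal.mem_sup_left hi) ?_
  have h4 : maximalIdeal R ^ n * I₀ ⊔ maximalIdeal R ^ n * Ideal.span {u} ≤
      I₀ ⊔ Ideal.span {u} * maximalIdeal R ^ n := by
    refine sup_le (Ideal.mul_le_right.trans le_sup_left) ?_
    rw [mul_comm]; exact le_sup_right
  exact h4 h3

lemma multi_lift {R σ : Type*} [Fintype σ] [CommRing R] [IsNoetherianRing R] [IsLocalRing R]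
    [IsAdicComplete (maximalIdeal R) R] (T : Ideal R) (hT : T ≤ maximalIdeal R) :
    ∀ (ts : List R), (∀ t ∈ ts, t ∈ T) → ∀ I₀ : Ideal R, ∃ Is : Ideal R, I₀ ≤ Is ∧
      (∀ t ∈ ts, t ∈ Is.radical) ∧ Is ≤ I₀ ⊔ maximalIdeal R * T ∧
      ∃ e : ℕ, ∀ (I : Ideal (MvPolynomial σ R)) (n : ℕ) (a : σ → R), 1 ≤ n →
        (∀ p ∈ I, eval a p ∈ Is) → (∀ p ∈ I, eval a p ∈ I₀ ⊔ maximalIdeal R ^ (n + e)) →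
        T ≤ (goodIdeal I).map (eval a) →
        ∃ b : σ → R, (∀ k, a k - b k ∈ maximalIdeal R ^ n) ∧
          (∀ k, a k - b k ∈ maximalIdeal R * T) ∧ ∀ p ∈ I, eval b p ∈ I₀ := by
  intro ts
  induction ts with
  | nil =>
    intro _ I₀
    exact ⟨I₀, le_rfl, by simp, le_sup_left, 0, fun I n a hn h1 h2 h3 =>
      ⟨a, by simp, by simp, h1⟩⟩
  | cons t ts ih =>
    intro hts I₀
    have htT : t ∈ T := hts t (by simp)
    obtain ⟨c, hc, hann⟩ := exists_stable_colon I₀ t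
    obtain ⟨k, hk⟩ := artin_rees_rel I₀ (t ^ c)
    obtain ⟨Is, hIs, hrad, hle, e, he⟩ := ih (fun t ht => hts t (by simp [ht]))
      (I₀ ⊔ Ideal.span {t ^ c})
    have htc : t ^ c ∈ maximalIdeal R * T := by
      obtain ⟨d, rfl⟩ := Nat.exists_eq_add_of_le hc
      rw [show 2 + d = (d + 1) + 1 by ring, pow_succ, pow_succ]
      exact Ideal.mul_mem_mul (Ideal.mul_mem_left _ _ (hT htT)) htT
    refine ⟨Is, le_sup_left.trans hIs, ?_, ?_, k + e, ?_⟩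
    · intro t' ht'
      rcases List.mem_cons.1 ht' with rfl | ht'
      · exact ⟨c, hIs (Ideal.mem_sup_right (Ideal.mem_span_singleton_self _))⟩
      · exact hrad t' ht'
    · refine hle.trans (sup_le (sup_le le_sup_left ?_) le_sup_right)
      rw [Ideal.span_singleton_le_iff_mem]
      exact Ideal.mem_sup_right htc
    · intro I n a hn h1 h2 h3
      obtain ⟨b1, hb1, hb2, hb3⟩ := he I (n + k) a (by omega) h1 (fun p hp => by
        have := h2 p hp
        rw [← add_assoc] at this
        exact (sup_le_sup_right le_sup_left _ : I₀ ⊔ maximalIdeal R ^ (n + k + e) ≤ _) this) h3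
      have h4 : ∀ p ∈ I, eval b1 p ∈ I₀ ⊔ Ideal.span {t ^ c} * maximalIdeal R ^ n := by
        intro p hp
        refine hk n ⟨hb3 p hp, ?_⟩
        have h5 := eval_sub_eval_mem _ a b1 hb1 p
        have h6 : eval a p ∈ I₀ ⊔ maximalIdeal R ^ (n + k) :=
          (sup_le_sup_left (Ideal.pow_le_pow_right (by omega)) _ :
            I₀ ⊔ maximalIdeal R ^ (n + (k + e)) ≤ _) (h2 p hp)
        have h7 := Ideal.sub_mem _ h6 (Ideal.mem_sup_right h5)
        rwa [sub_sub_cancel] at h7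
      have h8 : T ≤ (goodIdeal I).map (eval b1) :=
        nakayama_le _ _ (h3.trans (map_eval_le _ a b1 hb2 _))
      have hsurj : Function.Surjective (eval b1 : MvPolynomial σ R →+* R) := fun r =>
        ⟨C r, eval_C r⟩
      obtain ⟨h, hh, hht⟩ := (Ideal.mem_map_iff_of_surjective _ hsurj).1 (h8 htT)
      obtain ⟨b, hb4, hb5⟩ := newton I₀ I t c n hc hn hann b1 h hh hht h4
      have hle1 : Ideal.span {t} * maximalIdeal R ^ n ≤ maximalIdeal R ^ n := Ideal.mul_le_right
      have hle2 : Ideal.span {t} * maximalIdeal R ^ n ≤ maximalIdeal R * T := by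
        rw [mul_comm]
        refine Ideal.mul_mono ?_ ((Ideal.span_singleton_le_iff_mem _).2 htT)
        exact Ideal.pow_le_self (by omega)
      refine ⟨b, fun j => ?_, fun j => ?_, hb5⟩
      · have := Ideal.add_mem _ (Ideal.pow_le_pow_right (show n ≤ n + k by omega) (hb1 j))
          (hle1 (hb4 j))
        rwa [sub_add_sub_cancel] at this
      · have := Ideal.add_mem _ (hb2 j) (hle2 (hb4 j))
        rwa [sub_add_sub_cancel] at this

lemma minor_mul_mem_goodIdeal {R σ : Type*} [Fintype σ] [DecidableEq σ] [CommRing R]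
    (I : Ideal (MvPolynomial σ R)) {p : ℕ} (f : Fin p → MvPolynomial σ R) (hf : ∀ j, f j ∈ I)
    (cols : Fin p → σ) (g : MvPolynomial σ R)
    (hg : ∀ F ∈ I, g * F ∈ Ideal.span (Set.range f)) :
    (Matrix.of fun j k : Fin p => pderiv (cols k) (f j)).det * g ∈ goodIdeal I := by
  set J : Matrix (Fin p) (Fin p) (MvPolynomial σ R) :=
    Matrix.of fun j k : Fin p => pderiv (cols k) (f j) with hJ
  let A : Fin p → MvPolynomial σ R := fun l => ∑ j, J.adjugate l j * f j
  have hA : ∀ l, A l ∈ I := fun l => Ideal.sum_mem _ fun j _ => I.mul_mem_left _ (hf j)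
  refine ⟨fun k => g * ∑ l, if cols l = k then A l else 0, fun k => ?_, fun F hF => ?_⟩
  · refine I.mul_mem_left _ (Ideal.sum_mem _ fun l _ => ?_)
    split_ifs
    · exact hA l
    · exact I.zero_mem
  have e1 : ∑ k, pderiv k F * (g * ∑ l, if cols l = k then A l else 0)
      = ∑ l, g * pderiv (cols l) F * A l := by
    simp only [Finset.mul_sum]
    rw [Finset.sum_comm]
    refine Finset.sum_congr rfl fun l _ => ?_
    rw [Finset.sum_eq_single (cols l)]
    · rw [if_pos rfl]; ring
    · intro k _ hk; rw [if_neg (Ne.symm hk)]; ring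
    · intro h; exact absurd (Finset.mem_univ _) h
  rw [e1]
  obtain ⟨q, hq⟩ := (Submodule.mem_span_range_iff_exists_fun _).1 (hg F hF)
  simp only [smul_eq_mul] at hq
  have e2 : ∀ c : σ, g * pderiv c F - ∑ j, q j * pderiv c (f j) ∈ I := by
    intro c
    have h1 := congrArg (pderiv c) hq
    rw [map_sum, Derivation.leibniz] at h1
    simp only [Derivation.leibniz, smul_eq_mul, Finset.sum_add_distrib] at h1
    have h2 : g * pderiv c F - ∑ j, q j * pderiv c (f j) =
        ∑ j, f j * pderiv c (q j) - F * pderiv c g := by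
      linear_combination -h1
    rw [h2]
    exact I.sub_mem (Ideal.sum_mem _ fun j _ => I.mul_mem_right _ (hf j)) (I.mul_mem_right _ hF)
  have e3 : ∑ l, (∑ j, q j * pderiv (cols l) (f j)) * A l = J.det * g * F := by
    have h1 : ∀ l, (∑ j, q j * pderiv (cols l) (f j)) * A l =
        ∑ j, ∑ j', q j * f j' * (J j l * J.adjugate l j') := by
      intro l
      simp only [A]
      rw [Finset.sum_mul_sum]
      refine Finset.sum_congr rfl fun j _ => Finset.sum_congr rfl fun j' _ => ?_
      simp only [hJ, Matrix.of_apply]; ring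
    simp only [h1]
    rw [Finset.sum_comm]
    have h2 : ∀ j, ∑ l, ∑ j', q j * f j' * (J j l * J.adjugate l j') = J.det * (q j * f j) := by
      intro j
      rw [Finset.sum_comm]
      have h3 : ∀ j', ∑ l, q j * f j' * (J j l * J.adjugate l j') =
          q j * f j' * (J.det • (1 : Matrix (Fin p) (Fin p) (MvPolynomial σ R))) j j' := by
        intro j'
        rw [← Finset.mul_sum, ← Matrix.mul_adjugate, Matrix.mul_apply]
      simp only [h3]
      rw [Finset.sum_eq_single j]
      · simp; ring
      · intro j' _ hj'; simp [Ne.symm hj']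
      · intro h; exact absurd (Finset.mem_univ _) h
    simp only [h2]
    rw [← Finset.mul_sum, hq]; ring
  rw [← e3, ← Finset.sum_sub_distrib]
  refine Ideal.sum_mem _ fun l _ => ?_
  rw [← sub_mul, pow_two]
  refine Ideal.mul_mem_mul ?_ (hA l)
  rw [← neg_sub]
  exact I.neg_mem (e2 _)

lemma elkikH_le_goodIdeal {R σ : Type*} [Fintype σ] [DecidableEq σ] [CommRing R] {r : ℕ}
    (f : Fin r → MvPolynomial σ R) : elkikH f ≤ goodIdeal (Ideal.span (Set.range f)) := by
  unfold elkikH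
  refine iSup_le fun p => iSup_le fun _ => iSup_le fun rows => iSup_le fun _ => ?_
  rw [Ideal.mul_le]
  intro d hd g hg
  rw [Submodule.mem_colon] at hg
  induction hd using Submodule.span_induction with
  | mem d hd =>
    obtain ⟨cols, rfl⟩ := hd
    exact minor_mul_mem_goodIdeal _ (f ∘ rows)
      (fun j => Ideal.subset_span (Set.mem_range_self (f := f) (rows j))) cols g (fun F hF => hg F hF)
  | zero => rw [zero_mul]; exact Ideal.zero_mem _
  | add x y _ _ hx hy => rw [add_mul]; exact Ideal.add_mem _ hx hy
  | smul c x _ hx => rw [smul_eq_mul, mul_assoc]; exact Ideal.mul_mem_left _ _ hx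


lemma height_ge_of_params {R : Type*} [CommRing R] {s : ℕ} (t : Fin s → R)
    (ht : ∀ i : Fin s, ∀ P ∈ (Ideal.span (t '' {j | j < i})).minimalPrimes, t i ∉ P) :
    ∀ i : ℕ, i ≤ s → ∀ q : Ideal R, q.IsPrime → (∀ j : Fin s, (j : ℕ) < i → t j ∈ q) →
      (i : ℕ∞) ≤ q.height := by
  intro i
  induction i with
  | zero => intro _ q _ _; simp
  | succ i ih =>
    intro hi q hq hqt
    have hle : Ideal.span (t '' {j | j < (⟨i, by omega⟩ : Fin s)}) ≤ q := by
      rw [Ideal.span_le]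
      rintro _ ⟨j, hj, rfl⟩
      have hj' : (j : ℕ) < i := hj
      exact hqt j (by omega)
    obtain ⟨P, hP, hPq⟩ := Ideal.exists_minimalPrimes_le hle
    have hPp : P.IsPrime := hP.1.1
    have h1 := ih (by omega) P hPp (fun j hj =>
      hP.1.2 (Ideal.subset_span ⟨j, (show j < (⟨i, by omega⟩ : Fin s) from hj), rfl⟩))
    have hlt : P < q := lt_of_le_of_ne hPq (by
      rintro rfl
      exact ht ⟨i, by omega⟩ P hP (hqt ⟨i, by omega⟩ (by simp)))
    have h2 := Ideal.height_add_one_le_of_lt_of_isPrime hlt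
    push_cast
    exact (add_le_add_left h1 1).trans h2

lemma exists_last_param {R : Type*} [CommRing R] [IsNoetherianRing R] [IsLocalRing R]
    (d : ℕ) (hd : ringKrullDim R = d) (t : Fin (d - 1) → R)
    (ht : ∀ i : Fin (d - 1), ∀ P ∈ (Ideal.span (t '' {j | j < i})).minimalPrimes, t i ∉ P)
    (htm : ∀ i, t i ∈ maximalIdeal R) :
    ∃ x ∈ maximalIdeal R,
      maximalIdeal R ≤ (Ideal.span (Set.range t) ⊔ Ideal.span {x}).radical := by
  set T := Ideal.span (Set.range t) with hT
  have hfin : (T.minimalPrimes \ {maximalIdeal R}).Finite :=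
    (Ideal.finite_minimalPrimes_of_isNoetherianRing R T).subset Set.sdiff_subset
  have hx : ∃ x ∈ maximalIdeal R, ∀ P ∈ T.minimalPrimes \ {maximalIdeal R}, x ∉ P := by
    by_contra hcon
    push Not at hcon
    have hsub : (maximalIdeal R : Set R) ⊆
        ⋃ P ∈ (T.minimalPrimes \ {maximalIdeal R}), (P : Set R) := by
      intro x hx
      obtain ⟨P, hP, hxP⟩ := hcon x hx
      exact Set.mem_biUnion hP hxP
    replace hsub := (Ideal.subset_union_prime_finite hfin (f := fun P : Ideal R => P) ⊥ ⊥
      (fun P hP _ _ => hP.1.1.1)).1 hsub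
    obtain ⟨P, hP, hle⟩ := hsub
    have hPp : P.IsPrime := hP.1.1.1
    exact hP.2 (le_antisymm (IsLocalRing.le_maximalIdeal hPp.ne_top) hle)
  obtain ⟨x, hxm, hx⟩ := hx
  refine ⟨x, hxm, ?_⟩
  rw [Ideal.radical_eq_sInf]
  refine le_sInf ?_
  rintro q ⟨hq, hqp⟩
  obtain ⟨P, hP, hPq⟩ := Ideal.exists_minimalPrimes_le (le_sup_left.trans hq)
  have hPp : P.IsPrime := hP.1.1
  by_cases hPm : P = maximalIdeal R
  · rw [← hPm]; exact hPq
  have hxq : x ∈ q := hq (Ideal.mem_sup_right (Ideal.mem_span_singleton_self x))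
  have hlt : P < q := lt_of_le_of_ne hPq (by
    rintro rfl
    exact hx P ⟨hP, hPm⟩ hxq)
  by_contra hqm
  have hqm' : q < maximalIdeal R :=
    lt_of_le_of_ne (IsLocalRing.le_maximalIdeal hqp.ne_top) (by rintro rfl; exact hqm le_rfl)
  have h0 := height_ge_of_params t ht (d - 1) le_rfl P hPp
    (fun j _ => hP.1.2 (Ideal.subset_span ⟨j, rfl⟩))
  have h1 := Ideal.height_add_one_le_of_lt_of_isPrime hlt
  have h2 := Ideal.height_add_one_le_of_lt_of_isPrime hqm'
  have h3 : ((maximalIdeal R).height : WithBot ℕ∞) = ((d : ℕ∞) : WithBot ℕ∞) := by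
    rw [IsLocalRing.maximalIdeal_height_eq_ringKrullDim, hd]; rfl
  have h4 : (maximalIdeal R).height = (d : ℕ∞) := WithBot.coe_injective h3
  have h5 : ((d - 1 : ℕ) : ℕ∞) + 1 + 1 ≤ (d : ℕ∞) := by
    rw [← h4]
    exact (add_le_add_left ((add_le_add_left h0 1).trans h1) 1).trans h2
  have h6 : d - 1 + 1 + 1 ≤ d := by exact_mod_cast h5
  omega


lemma core_bound {R : Type*} [CommRing R] [IsNoetherianRing R] [IsLocalRing R]
    [IsAdicComplete (maximalIdeal R) R] (K : Type*) [Field K] [Algebra K R]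
    (N r s : ℕ) (f : Fin r → MvPolynomial (Fin N) R) (t : Fin s → R)
    (htm : Ideal.span (Set.range t) ≤ maximalIdeal R) (x : R) (hx : x ∈ maximalIdeal R)
    (hrad : maximalIdeal R ≤ (Ideal.span (Set.range t) ⊔ Ideal.span {x}).radical) :
    ∃ c e : ℕ, ∀ n : ℕ, ∀ a : Fin N → R,
      (∀ i, eval a (f i) ∈ maximalIdeal R ^ (c * n + e)) →
      Ideal.span (Set.range t) ≤
        Ideal.span (Set.range fun i => eval a (f i)) ⊔ Ideal.map (eval a) (elkikH f) →
      ∃ b : Fin N → R, (∀ i, eval b (f i) = 0) ∧ ∀ j, a j - b j ∈ maximalIdeal R ^ n := by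
  classical
  set T := Ideal.span (Set.range t) with hT
  have htT : ∀ j, t j ∈ T := fun j => Ideal.subset_span ⟨j, rfl⟩
  obtain ⟨Is, -, hIr, hIm, e', hlift⟩ := multi_lift (σ := Fin N) T htm (List.ofFn t)
    (by
      intro y hy
      rw [List.mem_ofFn] at hy
      obtain ⟨j, rfl⟩ := hy
      exact htT j) ⊥
  have hTr : T ≤ Is.radical := by
    rw [hT, Ideal.span_le]
    rintro _ ⟨j, rfl⟩
    exact hIr _ (by rw [List.mem_ofFn]; exact ⟨j, rfl⟩)
  have hrad2 : maximalIdeal R ≤ (Is ⊔ Ideal.span {x}).radical := by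
    refine hrad.trans ?_
    rw [← Ideal.radical_idem (Is ⊔ Ideal.span {x})]
    refine Ideal.radical_mono (sup_le ?_ ?_)
    · exact hTr.trans (Ideal.radical_mono le_sup_left)
    · exact le_sup_right.trans Ideal.le_radical
  obtain ⟨k, hk⟩ := Ideal.exists_pow_le_of_le_radical_of_fg hrad2
    (IsNoetherian.noetherian (maximalIdeal R))
  -- generators of `(f) + H`
  obtain ⟨q, h, hh⟩ := Submodule.fg_iff_exists_fin_generating_family.1
    (IsNoetherian.noetherian (Ideal.span (Set.range f) ⊔ elkikH f))
  let F : Fin r ⊕ Fin s → MvPolynomial (Fin N ⊕ Fin s × Fin q) R :=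
    Sum.elim (fun i => rename Sum.inl (f i))
      (fun j => C (t j) - ∑ l, rename Sum.inl (h l) * X (Sum.inr (j, l)))
  have hF1 : ∀ (w : Fin N ⊕ Fin s × Fin q → R) i,
      eval w (F (Sum.inl i)) = eval (w ∘ Sum.inl) (f i) := by
    intro w i
    simp [F, eval_rename]
  have hF2 : ∀ (w : Fin N ⊕ Fin s × Fin q → R) j,
      eval w (F (Sum.inr j)) = t j - ∑ l, eval (w ∘ Sum.inl) (h l) * w (Sum.inr (j, l)) := by
    intro w j
    simp [F, eval_rename]
  obtain ⟨c, e, hg⟩ := rel_greenberg K Is x hx k hk F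
  refine ⟨c + 1, c * (1 + e') + e + 1 + e', fun n a ha hH => ?_⟩
  have hsup : ∀ y : Fin N → R, Ideal.span (Set.range fun i => eval y (f i)) =
      Ideal.map (eval y) (Ideal.span (Set.range f)) := by
    intro y
    rw [Ideal.map_span, ← Set.range_comp]
    rfl
  have hmapspan : ∀ y : Fin N → R, Ideal.map (eval y) (Ideal.span (Set.range f) ⊔ elkikH f) =
      Ideal.span (Set.range fun l => eval y (h l)) := by
    intro y
    rw [← hh]
    change Ideal.map (eval y) (Ideal.span (Set.range h)) = _
    rw [Ideal.map_span, ← Set.range_comp]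
    rfl
  rw [hsup, ← Ideal.map_sup, hmapspan] at hH
  have hz : ∀ j, ∃ z : Fin q → R, ∑ l, z l * eval a (h l) = t j := fun j =>
    (Ideal.mem_span_range_iff_exists_fun).1 (hH (htT j))
  choose z hz using hz
  obtain ⟨w, hw1, hw2⟩ := hg (n + 1 + e') (Sum.elim a fun p => z p.1 p.2) (by
    rintro (i | j)
    · rw [hF1]
      refine Ideal.mem_sup_right (Ideal.pow_le_pow_right ?_ (ha i))
      nlinarith
    · rw [hF2]
      have : t j - ∑ l, eval ((Sum.elim a fun p : Fin s × Fin q => z p.1 p.2) ∘ Sum.inl) (h l) *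
          (Sum.elim a fun p : Fin s × Fin q => z p.1 p.2) (Sum.inr (j, l)) = 0 := by
        rw [sub_eq_zero, ← hz j]
        refine Finset.sum_congr rfl fun l _ => ?_
        simp [mul_comm]
      rw [this]
      exact Ideal.zero_mem _)
  set a' : Fin N → R := w ∘ Sum.inl with ha'
  have haa' : ∀ j, a j - a' j ∈ maximalIdeal R ^ (n + 1 + e') := fun j => hw2 (Sum.inl j)
  have hfa' : ∀ i, eval a' (f i) ∈ Is := fun i => by rw [← hF1]; exact hw1 _
  have hspan : ∀ (y : Fin N → R) (L : Ideal R), (∀ i, eval y (f i) ∈ L) →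
      ∀ p ∈ Ideal.span (Set.range f), eval y p ∈ L := by
    intro y L hL p hp
    have : Ideal.span (Set.range f) ≤ L.comap (eval y) := by
      rw [Ideal.span_le]
      rintro _ ⟨i, rfl⟩
      exact hL i
    exact this hp
  have hT1 : T ≤ (goodIdeal (Ideal.span (Set.range f))).map (eval a') := by
    refine nakayama_le _ _ ?_
    have hle : Ideal.span (Set.range fun l => eval a' (h l)) ≤
        (goodIdeal (Ideal.span (Set.range f))).map (eval a') ⊔ Is := by
      rw [← hmapspan, Ideal.map_sup, ← hsup]
      refine sup_le ?_ ?_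
      · rw [Ideal.span_le]
        rintro _ ⟨i, rfl⟩
        exact Ideal.mem_sup_right (hfa' i)
      · exact (Ideal.map_mono (elkikH_le_goodIdeal f)).trans le_sup_left
    have hTT : T ≤ (goodIdeal (Ideal.span (Set.range f))).map (eval a') ⊔ Is := by
      rw [hT, Ideal.span_le]
      rintro _ ⟨j, rfl⟩
      have h1 := hw1 (Sum.inr j)
      rw [hF2] at h1
      have h2 : ∑ l, eval a' (h l) * w (Sum.inr (j, l)) ∈
          Ideal.span (Set.range fun l => eval a' (h l)) :=
        Ideal.sum_mem _ fun l _ => Ideal.mul_mem_right _ _ (Ideal.subset_span ⟨l, rfl⟩)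
      have h3 := Ideal.add_mem _ (Ideal.mem_sup_right h1) (hle h2)
      rwa [sub_add_cancel] at h3
    refine hTT.trans (sup_le_sup_left ?_ _)
    simpa using hIm
  obtain ⟨b, hb1, -, hb3⟩ := hlift (Ideal.span (Set.range f)) (n + 1) a' (by omega)
    (hspan a' Is hfa')
    (hspan a' _ fun i => by
      refine Ideal.mem_sup_right ?_
      have h1 := eval_sub_eval_mem _ a a' haa' (f i)
      have h2 : eval a (f i) ∈ maximalIdeal R ^ (n + 1 + e') :=
        Ideal.pow_le_pow_right (by nlinarith) (ha i)
      have h3 := Ideal.sub_mem _ h2 h1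
      rwa [sub_sub_cancel] at h3) hT1
  refine ⟨b, fun i => by simpa using hb3 _ (Ideal.subset_span ⟨i, rfl⟩), fun j => ?_⟩
  have h1 := Ideal.add_mem _ (Ideal.pow_le_pow_right (show n ≤ n + 1 + e' by omega) (haa' j))
    (Ideal.pow_le_pow_right (show n ≤ n + 1 by omega) (hb1 j))
  rwa [sub_add_sub_cancel] at h1

theorem artin_bound_linear_of_elkik_contains_parameters
    (R : Type*) [CommRing R] [IsNoetherianRing R] [IsLocalRing R]
    [IsAdicComplete (maximalIdeal R) R]
    (K : Type*) [Field K] [Algebra K R]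
    (d : ℕ) (hd : ringKrullDim R = d)
    (N r : ℕ) (f : Fin r → MvPolynomial (Fin N) R)
    (t : Fin (d - 1) → R)
    (ht : ∀ i : Fin (d - 1), ∀ P ∈ (Ideal.span (t '' {j | j < i})).minimalPrimes, t i ∉ P) :
    ∃ c e : ℕ, ∀ n : ℕ, ∀ a : Fin N → R,
      (∀ i, eval a (f i) ∈ maximalIdeal R ^ (c * n + e)) →
      Ideal.span (Set.range t) ≤
        Ideal.span (Set.range fun i => eval a (f i)) ⊔ Ideal.map (eval a) (elkikH f) →
      ∃ b : Fin N → R, (∀ i, eval b (f i) = 0) ∧ ∀ j, a j - b j ∈ maximalIdeal R ^ n := by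
  by_cases htm : ∀ i, t i ∈ maximalIdeal R
  · obtain ⟨x, hx, hrad⟩ := exists_last_param d hd t ht htm
    refine core_bound K N r (d - 1) f t ?_ x hx hrad
    rw [Ideal.span_le]
    rintro _ ⟨i, rfl⟩
    exact htm i
  · push Not at htm
    obtain ⟨i, hi⟩ := htm
    have hu : IsUnit (t i) := by
      by_contra hcon
      exact hi ((IsLocalRing.mem_maximalIdeal _).2 hcon)
    have htop : Ideal.span (Set.range t) = ⊤ :=
      Ideal.eq_top_of_isUnit_mem _ (Ideal.subset_span ⟨i, rfl⟩) hu
    obtain ⟨s, u, hus⟩ := Submodule.fg_iff_exists_fin_generating_family.1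
      (IsNoetherian.noetherian (maximalIdeal R))
    have hus' : Ideal.span (Set.range u) = maximalIdeal R := hus
    obtain ⟨c, e, h⟩ := core_bound K N r s f u hus'.le 0 (Ideal.zero_mem _)
      (by rw [hus']; exact le_sup_left.trans Ideal.le_radical)
    refine ⟨c, e, fun n a ha hH => h n a ha (le_trans ?_ hH)⟩
    rw [htop]
    exact le_top
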